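/- arXiv:2103.02960 — 3 statements merged into one kernel-verified Lean document; each statement's English description precedes it below -/
import Mathlib

section
/- There is an absolute constant A > 0 with the following property. Let S be a finite family of n curves in the plane, each colored red or blue, such that no two curves of the same color intersect, and let C be a family of pairwise disjoint curves which is grounded with respect to S. Then for every integer k ≥ 2, the number of distinct hyperedges of size at most k of the intersection hypergraph H(S, C) is at most A·k^7·n. -/
open Set

/-- Points of the plane. -/
abbrev Pt : Type := ℝ × ℝ

/-- A curve: the image of an injective continuous map from `[0,1]` to the plane. -/
def IsCurve (s : Set Pt) : Prop :=
  ∃ f : ℝ → Pt, ContinuousOn f (Set.Icc 0 1) ∧ Set.InjOn f (Set.Icc 0 1) ∧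
    s = f '' Set.Icc 0 1

/-- A simple polygonal chain consisting of finitely many line segments. -/
def IsPolygonalCurve (s : Set Pt) : Prop :=
  IsCurve s ∧ ∃ P : Finset (Pt × Pt), s = ⋃ p ∈ P, segment ℝ p.1 p.2

/-- The family `C` is grounded with respect to `S` if some connected component of the
complement of `⋃ S` contains at least one point of every curve in `C`. -/
def Grounded {ι κ : Type*} (C : ι → Set Pt) (S : κ → Set Pt) : Prop :=
  ∃ x : Pt, x ∉ (⋃ k, S k) ∧
    ∀ i, (connectedComponentIn (⋃ k, S k)ᶜ x ∩ C i).Nonempty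

/-! ### The square grid as a planar map -/

/-- The vertices of the square grid. -/
abbrev Vtx : Type := ℤ × ℤ

/-- A dart of the grid: a vertex with one of the four directions, in counterclockwise order. -/
abbrev Dart : Type := Vtx × Fin 4

/-- The unit vectors in the four directions. -/
def dirVec : Fin 4 → Vtx := ![(1, 0), (0, 1), (-1, 0), (0, -1)]

/-- The vertex a dart points to. -/
def Dart.head (d : Dart) : Vtx := d.1 + dirVec d.2

/-- The dart on the same edge in the opposite direction. -/
def Dart.rev (d : Dart) : Dart := (d.head, d.2 + 2)

/-- Adjacency in the grid. -/
def GridAdj (u v : Vtx) : Prop := ∃ k : Fin 4, v = u + dirVec k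

theorem dirVec_add_two (k : Fin 4) : dirVec (k + 2) = -dirVec k := by
  fin_cases k <;> simp [dirVec]

theorem Dart.head_rev (d : Dart) : d.rev.head = d.1 := by
  simp [Dart.rev, Dart.head, dirVec_add_two]

theorem Dart.rev_rev (d : Dart) : d.rev.rev = d := by
  obtain ⟨p, k⟩ := d
  refine Prod.ext (Dart.head_rev _) ?_
  change k + 2 + 2 = k
  fin_cases k <;> rfl

theorem GridAdj.symm {u v : Vtx} (h : GridAdj u v) : GridAdj v u := by
  obtain ⟨k, rfl⟩ := h
  exact ⟨k + 2, by simp [dirVec_add_two]⟩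

theorem GridAdj.exists_dart {u v : Vtx} (h : GridAdj u v) : ∃ d : Dart, d.1 = u ∧ d.head = v := by
  obtain ⟨k, rfl⟩ := h
  exact ⟨(u, k), rfl, rfl⟩

/-- A mod 2 chain of edges of the grid with finite support. -/
structure IsEdgeChain (z : Dart → ZMod 2) : Prop where
  rev : ∀ d, z d.rev = z d
  fin : (Function.support z).Finite

/-- The boundary of a mod 2 chain of edges. -/
def edgeBoundary (z : Dart → ZMod 2) (v : Vtx) : ZMod 2 := ∑ k : Fin 4, z (v, k)

theorem IsEdgeChain.add {z z' : Dart → ZMod 2} (h : IsEdgeChain z) (h' : IsEdgeChain z') :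
    IsEdgeChain (z + z') :=
  ⟨fun d => by simp [h.rev, h'.rev],
    (h.fin.union h'.fin).subset (Function.support_add z z')⟩

theorem edgeBoundary_add (z z' : Dart → ZMod 2) (v : Vtx) :
    edgeBoundary (z + z') v = edgeBoundary z v + edgeBoundary z' v := by
  simp [edgeBoundary, Finset.sum_add_distrib]

/-- The chain consisting of a single edge. -/
def edgeOf (d : Dart) : Dart → ZMod 2 := Pi.single d 1 + Pi.single d.rev 1

theorem edgeOf_apply (d e : Dart) :
    edgeOf d e = (if e = d then 1 else 0) + (if e = d.rev then 1 else 0) := by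
  simp [edgeOf, Pi.single_apply]

theorem edgeOf_eq_zero {d e : Dart} (h : e ≠ d) (h' : e ≠ d.rev) : edgeOf d e = 0 := by
  simp [edgeOf_apply, h, h']

theorem isEdgeChain_edgeOf (d : Dart) : IsEdgeChain (edgeOf d) := by
  refine ⟨fun e => ?_, ?_⟩
  · rw [edgeOf_apply, edgeOf_apply, add_comm]
    congr 1
    · exact if_congr ⟨fun h => by rw [← e.rev_rev, h, d.rev_rev], fun h => by rw [h]⟩ rfl rfl
    · exact if_congr ⟨fun h => by rw [← h, e.rev_rev], fun h => by rw [h, d.rev_rev]⟩ rfl rfl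
  · refine (Set.toFinite {d, d.rev}).subset fun e he => ?_
    by_contra h
    simp only [Set.mem_insert_iff, Set.mem_singleton_iff, not_or] at h
    exact he (edgeOf_eq_zero h.1 h.2)

theorem edgeBoundary_edgeOf (d : Dart) (v : Vtx) :
    edgeBoundary (edgeOf d) v = (if v = d.1 then 1 else 0) + (if v = d.head then 1 else 0) := by
  obtain ⟨p, k⟩ := d
  simp only [edgeBoundary, edgeOf_apply, Finset.sum_add_distrib, Prod.mk.injEq, Dart.rev, ite_and]
  congr 1
  · split_ifs <;> simp
  · split_ifs <;> simp

theorem zmod_two_add_self (a : ZMod 2) : a + a = 0 := CharTwo.add_self_eq_zero a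

/-- Every cycle of the grid bounds: there is a mod 2 function on faces, given here as a function of
the face to the left of a dart, which changes exactly across the edges of the cycle. -/
theorem exists_faceFun {z : Dart → ZMod 2} (hz : IsEdgeChain z) (hb : ∀ v, edgeBoundary z v = 0) :
    ∃ l : Dart → ZMod 2, (∀ d : Dart, l d.rev = l (d.1, d.2 + 3)) ∧
      ∀ d : Dart, l d = l (d.1, d.2 + 3) + z d := by
  obtain ⟨m, hm⟩ : ∃ m : ℤ, ∀ i j k, i < m → z ((i, j), k) = 0 := by
    obtain ⟨m, hm⟩ := (hz.fin.image (fun d => d.1.1)).bddBelow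
    refine ⟨m, fun i j k hi => ?_⟩
    by_contra h
    exact absurd (hm ⟨((i, j), k), h, rfl⟩) (not_le.2 hi)
  let W : Vtx → ZMod 2 := fun p => ∑ i ∈ Finset.Icc m p.1, z ((i, p.2), 1)
  have hW0 : ∀ i j, i < m → W (i, j) = 0 := fun i j h => by
    simp [W, Finset.Icc_eq_empty (not_le.2 h)]
  have hWv : ∀ i j, W (i, j) = W (i - 1, j) + z ((i, j), 1) := by
    intro i j
    by_cases h : i < m
    · rw [hW0 i j h, hW0 (i - 1) j (by omega), hm i j 1 h, add_zero]
    · have : Finset.Icc m i = insert i (Finset.Icc m (i - 1)) := by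
        ext a
        simp only [Finset.mem_Icc, Finset.mem_insert]
        omega
      simp only [W]
      rw [this, Finset.sum_insert (by simp), add_comm]
  have hr1 : ∀ i j, z ((i, j - 1), 1) = z ((i, j), 3) := by
    intro i j
    rw [← hz.rev ((i, j - 1), 1)]
    simp [Dart.rev, Dart.head, dirVec]
  have hr0 : ∀ i j, z ((i - 1, j), 0) = z ((i, j), 2) := by
    intro i j
    rw [← hz.rev ((i - 1, j), 0)]
    simp [Dart.rev, Dart.head, dirVec]
  have hWh : ∀ i j, W (i, j) = W (i, j - 1) + z ((i, j), 0) := by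
    have aux : ∀ a₀ a₁ a₂ a₃ w : ZMod 2, a₀ + a₁ + a₂ + a₃ = 0 →
        w + a₂ + a₁ = w + a₃ + a₀ := by decide
    have key : ∀ n : ℕ, ∀ j, W (m - 1 + n, j) = W (m - 1 + n, j - 1) + z ((m - 1 + n, j), 0) := by
      intro n
      induction n with
      | zero =>
        intro j
        rw [hW0 _ _ (by simp), hW0 _ _ (by simp), hm _ _ _ (by simp), add_zero]
      | succ n ih =>
        intro j
        have e : m - 1 + ((n + 1 : ℕ) : ℤ) - 1 = m - 1 + n := by push_cast; ring
        have h1 := hWv (m - 1 + ((n + 1 : ℕ) : ℤ)) j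
        have h2 := hWv (m - 1 + ((n + 1 : ℕ) : ℤ)) (j - 1)
        have h3 := hr0 (m - 1 + ((n + 1 : ℕ) : ℤ)) j
        have h4 := hr1 (m - 1 + ((n + 1 : ℕ) : ℤ)) j
        have h5 := hb (m - 1 + ((n + 1 : ℕ) : ℤ), j)
        simp only [edgeBoundary, Fin.sum_univ_four] at h5
        rw [e] at h1 h2 h3
        rw [h1, h2, ih j, h3, h4]
        exact aux _ _ _ _ _ h5
    intro i j
    by_cases h : i < m
    · rw [hW0 i j h, hW0 i _ h, hm i j 0 h, add_zero]
    · have := key (i - (m - 1)).toNat j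
      rwa [Int.toNat_of_nonneg (by omega), add_sub_cancel] at this
  refine ⟨fun d => ![W d.1, W (d.1 - (1, 0)), W (d.1 - (1, 1)), W (d.1 - (0, 1))] d.2, ?_, ?_⟩
  · rintro ⟨⟨i, j⟩, k⟩
    fin_cases k <;> simp [Dart.rev, Dart.head, dirVec, Fin.reduceFinMk] <;> rfl
  · rintro ⟨⟨i, j⟩, k⟩
    have e1 := hWh i j
    have e2 := hWv i j
    have e3 := hWh (i - 1) j
    have e4 := hWv i (j - 1)
    have e5 := hr0 i j
    have e6 := hr1 i j
    fin_cases k <;> simp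
    · exact e1
    · change W _ = W _ + _
      simp [e2, add_assoc, zmod_two_add_self]
    · change W _ = W _ + _
      simp [e3, e5, add_assoc, zmod_two_add_self]
    · change W _ = W _ + _
      simp [e4, e6]

/-! ### Connected sets of vertices -/

/-- Connectedness of a set of grid vertices. -/
def GConn (A : Set Vtx) : Prop :=
  ∀ P : Set Vtx, (∃ u ∈ A, u ∈ P) → (∀ u ∈ A, u ∈ P → ∀ v ∈ A, GridAdj u v → v ∈ P) →
    ∀ v ∈ A, v ∈ P

theorem gconn_singleton (v : Vtx) : GConn {v} := by
  rintro P ⟨u, rfl, hu⟩ - w rfl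
  exact hu

theorem GConn.union {A B : Set Vtx} (hA : GConn A) (hB : GConn B) (h : (A ∩ B).Nonempty) :
    GConn (A ∪ B) := by
  obtain ⟨w, hwA, hwB⟩ := h
  rintro P ⟨u, hu, huP⟩ hP v hv
  have hPA : (∃ u ∈ A, u ∈ P) → ∀ v ∈ A, v ∈ P := fun h =>
    hA P h fun u hu huP v hv => hP u (.inl hu) huP v (.inl hv)
  have hPB : (∃ u ∈ B, u ∈ P) → ∀ v ∈ B, v ∈ P := fun h =>
    hB P h fun u hu huP v hv => hP u (.inr hu) huP v (.inr hv)
  have hw : w ∈ P := by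
    rcases hu with hu | hu
    · exact hPA ⟨u, hu, huP⟩ w hwA
    · exact hPB ⟨u, hu, huP⟩ w hwB
  rcases hv with hv | hv
  · exact hPA ⟨w, hwA, hw⟩ v hv
  · exact hPB ⟨w, hwB, hw⟩ v hv

theorem gconn_pair {u v : Vtx} (h : GridAdj u v) : GConn {u, v} := by
  rintro P ⟨w, hw, hwP⟩ hP x hx
  have hu : u ∈ P := by
    rcases hw with rfl | rfl
    · exact hwP
    · exact hP _ (.inr rfl) hwP _ (.inl rfl) h.symm
  rcases hx with rfl | rfl
  · exact hu
  · exact hP _ (.inl rfl) hu _ (.inr rfl) h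

theorem GConn.union_of_adj {A B : Set Vtx} (hA : GConn A) (hB : GConn B) {u v : Vtx} (hu : u ∈ A)
    (hv : v ∈ B) (h : GridAdj u v) : GConn (A ∪ B) := by
  have := (hA.union (gconn_pair h) ⟨u, hu, .inl rfl⟩).union hB ⟨v, .inr (.inr rfl), hv⟩
  convert this using 1
  ext x
  simp only [mem_union, mem_insert_iff, mem_singleton_iff]
  constructor
  · tauto
  · rintro ((h | rfl | rfl) | h) <;> tauto

/-- Two vertices of a connected set are joined by a chain inside the set. -/
theorem GConn.exists_chain {A : Set Vtx} (hA : GConn A) {u v : Vtx} (hu : u ∈ A) (hv : v ∈ A) :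
    ∃ z, IsEdgeChain z ∧
      (∀ w, edgeBoundary z w = (if w = u then 1 else 0) + (if w = v then 1 else 0)) ∧
      ∀ d, z d ≠ 0 → d.1 ∈ A ∧ d.head ∈ A := by
  refine hA {v | ∃ z, IsEdgeChain z ∧
      (∀ w, edgeBoundary z w = (if w = u then 1 else 0) + (if w = v then 1 else 0)) ∧
      ∀ d, z d ≠ 0 → d.1 ∈ A ∧ d.head ∈ A} ⟨u, hu, 0, ⟨by simp, by simp⟩, fun w => ?_, by simp⟩ ?_
      v hv
  · rw [zmod_two_add_self]
    simp [edgeBoundary]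
  · rintro x hx ⟨z, hz, hb, hs⟩ y hy hxy
    obtain ⟨d, rfl, rfl⟩ := hxy.exists_dart
    refine ⟨z + edgeOf d, hz.add (isEdgeChain_edgeOf d), fun w => ?_, fun e he => ?_⟩
    · rw [edgeBoundary_add, hb, edgeBoundary_edgeOf, add_assoc, ← add_assoc _ _ (ite (w = d.head) _ _),
        zmod_two_add_self, zero_add]
    · by_cases hze : z e = 0
      · by_cases h1 : e = d
        · exact h1 ▸ ⟨hx, hy⟩
        by_cases h2 : e = d.rev
        · rw [h2, Dart.head_rev]
          exact ⟨hy, hx⟩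
        · simp [hze, edgeOf_eq_zero h1 h2] at he
      · exact hs e hze

theorem GConn.face_eq {A : Set Vtx} (hA : GConn A) {l z : Dart → ZMod 2}
    (h₁ : ∀ d : Dart, l d.rev = l (d.1, d.2 + 3)) (h₂ : ∀ d : Dart, l d = l (d.1, d.2 + 3) + z d)
    (hz : ∀ d : Dart, d.1 ∈ A → z d = 0) {d e : Dart} (hd : d.1 ∈ A) (he : e.1 ∈ A) :
    l d = l e := by
  have key : ∀ u ∈ A, ∀ k k', l (u, k) = l (u, k') := by
    intro u hu
    have h : ∀ k, l (u, k) = l (u, k + 3) := fun k => by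
      rw [h₂, hz (u, k) hu, add_zero]
    have h0 := h 0
    have h1 := h 1
    have h2 := h 2
    have h3 := h 3
    change l (u, 0) = l (u, 3) at h0
    change l (u, 1) = l (u, 0) at h1
    change l (u, 2) = l (u, 1) at h2
    intro k k'
    fin_cases k <;> fin_cases k' <;> simp [h2, h1, h0]
  have := hA {v | ∀ k, l (v, k) = l d} ⟨d.1, hd, fun k => key _ hd _ _⟩ ?_ e.1 he e.2
  · exact this.symm
  · rintro u hu hP v hv huv k
    obtain ⟨d', rfl, rfl⟩ := huv.exists_dart
    rw [key _ hv k (d'.2 + 2), ← hP (d'.2 + 3)]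
    exact h₁ d'

/-! ### Contours -/

/-- `Contour T B` says that `B` lists, in the order met when walking around a spanning tree of
`T`, the darts out of vertices of `T` which are not on the tree. -/
inductive Contour : Finset Vtx → List Dart → Prop
  | single (v : Vtx) : Contour {v} [(v, 0), (v, 1), (v, 2), (v, 3)]
  | step {T : Finset Vtx} {A B : List Dart} {d : Dart} (h : Contour T (A ++ d :: B))
      (hd : d.head ∉ T) :
      Contour (insert d.head T)
        (A ++ (d.head, d.2 + 3) :: (d.head, d.2) :: (d.head, d.2 + 1) :: B)

namespace Contour

variable {T : Finset Vtx} {B : List Dart}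

theorem tail_mem (h : Contour T B) : ∀ d ∈ B, d.1 ∈ T := by
  induction h with
  | single v => simp
  | step h hd ih =>
    intro e he
    simp only [List.mem_append, List.mem_cons] at he ih
    simp only [Finset.mem_insert]
    rcases he with he | rfl | rfl | rfl | he
    · exact .inr (ih _ (.inl he))
    · exact .inl rfl
    · exact .inl rfl
    · exact .inl rfl
    · exact .inr (ih _ (.inr (.inr he)))

theorem mem_of_exit (h : Contour T B) : ∀ d : Dart, d.1 ∈ T → d.head ∉ T → d ∈ B := by
  induction h with
  | single v =>
    rintro ⟨u, k⟩ hu -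
    simp only [Finset.mem_singleton] at hu
    subst hu
    fin_cases k <;> simp
  | @step T A B d h hd ih =>
    intro e he he'
    simp only [Finset.mem_insert, not_or] at he he'
    rcases he with he | he
    · obtain ⟨u, k⟩ := e
      simp only at he
      subst he
      have h2 : k ≠ d.2 + 2 := by
        rintro rfl
        apply he'.2
        change d.rev.head ∈ T
        rw [d.head_rev]
        exact h.tail_mem d (by simp)
      simp only [List.mem_append, List.mem_cons, Prod.mk.injEq, true_and]
      have aux : ∀ k j : Fin 4, k ≠ j + 2 → k = j + 3 ∨ k = j ∨ k = j + 1 := by decide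
      have : k = d.2 + 3 ∨ k = d.2 ∨ k = d.2 + 1 := by
        exact aux _ _ h2
      tauto
    · have := ih e he he'.2
      simp only [List.mem_append, List.mem_cons] at this ⊢
      rcases this with h | rfl | h
      · exact .inl h
      · exact absurd rfl he'.1
      · tauto

theorem nodup (h : Contour T B) : B.Nodup := by
  induction h with
  | single v => simp
  | @step T A B d h hd ih =>
    have h1 : ∀ k, (d.head, k) ∉ A := fun k hk => hd (h.tail_mem (d.head, k) (by simp [hk]))
    have h2 : ∀ k, (d.head, k) ∉ B := fun k hk => hd (h.tail_mem (d.head, k) (by simp [hk]))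
    have e1 : ∀ k : Fin 4, k + 3 ≠ k := by decide
    have e2 : ∀ k : Fin 4, k + 3 ≠ k + 1 := by decide
    have e3 : ∀ k : Fin 4, k ≠ k + 1 := by decide
    rw [List.nodup_append] at ih ⊢
    simp only [List.nodup_cons, List.mem_cons, not_or, Prod.mk.injEq, true_and, h2,
      not_false_eq_true, and_true, e1, e2, e3] at ih ⊢
    refine ⟨ih.1, ih.2.1.2, fun a ha b hb => ?_⟩
    rintro rfl
    rcases hb with rfl | rfl | rfl | hb
    · exact h1 _ ha
    · exact h1 _ ha
    · exact h1 _ ha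
    · exact ih.2.2 a ha a (.inr hb) rfl

theorem isChain (h : Contour T B) {l : Dart → ZMod 2}
    (hl : ∀ d : Dart, l d.rev = l (d.1, d.2 + 3)) :
    B.IsChain fun a b => l (b.1, b.2 + 3) = l a := by
  induction h with
  | single v =>
    simp only [List.isChain_cons_cons, List.isChain_singleton, and_true]
    exact ⟨rfl, rfl, rfl⟩
  | @step T A B d h hd ih =>
    have e1 : ∀ k : Fin 4, k + 3 + 3 = k + 2 := by decide
    have e2 : ∀ k : Fin 4, k + 1 + 3 = k := by decide
    have e3 : ∀ k : Fin 4, k + 2 + 3 = k + 1 := by decide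
    have h1 : l (d.head, d.2 + 3 + 3) = l (d.1, d.2 + 3) := by
      rw [e1, ← hl d]
      rfl
    have h2 : l (d.head, d.2 + 1) = l d := by
      have := hl d.rev
      rw [d.rev_rev] at this
      rw [this, ← e3]
      rfl
    rw [List.isChain_append] at ih ⊢
    refine ⟨ih.1, ?_, fun x hx y hy => ?_⟩
    · rw [List.isChain_cons_cons, List.isChain_cons_cons, List.isChain_cons]
      refine ⟨rfl, by rw [e2], fun y hy => ?_, (List.isChain_cons.1 ih.2.1).2⟩
      rw [h2]
      exact (List.isChain_cons.1 ih.2.1).1 y hy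
    · simp only [List.head?_cons, Option.mem_some_iff] at hy
      subst hy
      simp only
      rw [h1]
      exact ih.2.2 x hx d (by simp)

theorem exists_chain (h : Contour T B) : ∀ u ∈ T, ∀ v ∈ T,
    ∃ z, IsEdgeChain z ∧
      (∀ w, edgeBoundary z w = (if w = u then 1 else 0) + (if w = v then 1 else 0)) ∧
      (∀ d, z d ≠ 0 → d.1 ∈ T ∧ d.head ∈ T) ∧ ∀ d ∈ B, z d = 0 := by
  induction h with
  | single v =>
    intro u hu w hw
    simp only [Finset.mem_singleton] at hu hw
    subst hu hw
    refine ⟨0, ⟨by simp, by simp⟩, fun w => ?_, by simp, by simp⟩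
    rw [zmod_two_add_self]
    simp [edgeBoundary]
  | @step T A B d h hd ih =>
    have hdT : d.1 ∈ T := h.tail_mem d (by simp)
    have hnd := h.nodup
    have key : ∀ u ∈ insert d.head T, ∃ z, IsEdgeChain z ∧
        (∀ w, edgeBoundary z w = (if w = u then 1 else 0) + (if w = d.1 then 1 else 0)) ∧
        (∀ e, z e ≠ 0 → e.1 ∈ insert d.head T ∧ e.head ∈ insert d.head T) ∧
        ∀ e ∈ A ++ (d.head, d.2 + 3) :: (d.head, d.2) :: (d.head, d.2 + 1) :: B, z e = 0 := by
      intro u hu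
      rcases Finset.mem_insert.1 hu with rfl | hu
      · refine ⟨edgeOf d, isEdgeChain_edgeOf d, fun w => ?_, fun e he => ?_, fun e he => ?_⟩
        · rw [edgeBoundary_edgeOf, add_comm]
        · by_cases h1 : e = d
          · subst h1
            exact ⟨Finset.mem_insert_of_mem hdT, Finset.mem_insert_self _ _⟩
          by_cases h2 : e = d.rev
          · rw [h2, Dart.head_rev]
            exact ⟨Finset.mem_insert_self _ _, Finset.mem_insert_of_mem hdT⟩
          · exact absurd (edgeOf_eq_zero h1 h2) he
        · have e1 : ∀ k : Fin 4, k + 3 ≠ k + 2 := by decide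
          have e2 : ∀ k : Fin 4, k ≠ k + 2 := by decide
          have e3 : ∀ k : Fin 4, k + 1 ≠ k + 2 := by decide
          have hne : ∀ k, (d.head, k) ≠ d := by
            intro k hk
            apply hd
            rw [← hk] at hdT
            exact hdT
          have hr : ∀ k, k ≠ d.2 + 2 → (d.head, k) ≠ d.rev := by
            intro k hk h'
            exact hk (congrArg Prod.snd h')
          have hold : ∀ e ∈ A ++ B, edgeOf d e = 0 := by
            intro e he
            refine edgeOf_eq_zero ?_ ?_
            · exact fun h' => (List.nodup_middle.1 hnd).notMem (h' ▸ he)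
            · rintro rfl
              exact hd (h.tail_mem d.rev (by simp only [List.mem_append, List.mem_cons] at he ⊢; tauto))
          simp only [List.mem_append, List.mem_cons] at he hold
          rcases he with he | rfl | rfl | rfl | he
          · exact hold _ (.inl he)
          · exact edgeOf_eq_zero (hne _) (hr _ (e1 _))
          · exact edgeOf_eq_zero (hne _) (hr _ (e2 _))
          · exact edgeOf_eq_zero (hne _) (hr _ (e3 _))
          · exact hold _ (.inr he)
      · obtain ⟨z, hz, hb, hs, hB⟩ := ih u hu d.1 hdT
        refine ⟨z, hz, hb, fun e he => ⟨Finset.mem_insert_of_mem (hs e he).1,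
          Finset.mem_insert_of_mem (hs e he).2⟩, fun e he => ?_⟩
        have hn : ∀ k, z (d.head, k) = 0 := by
          intro k
          by_contra h'
          exact hd (hs _ h').1
        simp only [List.mem_append, List.mem_cons] at he hB
        rcases he with he | rfl | rfl | rfl | he
        · exact hB _ (.inl he)
        · exact hn _
        · exact hn _
        · exact hn _
        · exact hB _ (.inr (.inr he))
    intro u hu v hv
    obtain ⟨z, hz, hb, hs, hB⟩ := key u hu
    obtain ⟨z', hz', hb', hs', hB'⟩ := key v hv
    refine ⟨z + z', hz.add hz', fun w => ?_, fun e he => ?_, fun e he => ?_⟩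
    · rw [edgeBoundary_add, hb, hb', add_add_add_comm, zmod_two_add_self, add_zero]
    · by_cases h0 : z e = 0
      · exact hs' e (by simpa [h0] using he)
      · exact hs e h0
    · simp [hB e he, hB' e he]

theorem _root_.List.sublist_four_split {α : Type*} {a b c d : α} {l : List α}
    (h : [a, b, c, d].Sublist l) : ∃ l₀ l₁ l₂ l₃ l₄,
      l = l₀ ++ a :: (l₁ ++ b :: (l₂ ++ c :: (l₃ ++ d :: l₄))) := by
  obtain ⟨p, q, rfl, ha, h⟩ := List.cons_sublist_iff.1 h
  obtain ⟨p₂, q₂, rfl, hb, h⟩ := List.cons_sublist_iff.1 h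
  obtain ⟨p₃, q₃, rfl, hc, h₄⟩ := List.cons_sublist_iff.1 h
  obtain ⟨s, t, rfl⟩ := List.append_of_mem ha
  obtain ⟨s₂, t₂, rfl⟩ := List.append_of_mem hb
  obtain ⟨s₃, t₃, rfl⟩ := List.append_of_mem hc
  obtain ⟨s₄, t₄, rfl⟩ := List.append_of_mem (List.singleton_sublist.1 h₄)
  exact ⟨s, t ++ s₂, t₂ ++ s₃, t₃ ++ s₄, t₄, by simp⟩

/-- Two disjoint connected sets in the complement of a connected set are not reached in an
interlaced way from a contour. -/
theorem not_interlaced (h : Contour T B) {R₁ R₂ : Set Vtx} (hR₁ : GConn R₁) (hR₂ : GConn R₂)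
    (hR : Disjoint R₁ R₂) (hT₁ : ∀ v ∈ R₁, v ∉ T) (hT₂ : ∀ v ∈ R₂, v ∉ T)
    {d₁ d₂ d₃ d₄ : Dart} (hB : [d₁, d₂, d₃, d₄].Sublist B) (h₁ : d₁.head ∈ R₁)
    (h₂ : d₂.head ∈ R₂) (h₃ : d₃.head ∈ R₁) (h₄ : d₄.head ∈ R₂) : False := by
  have hmem := hB.subset
  simp only [List.cons_subset, List.nil_subset, and_true] at hmem
  obtain ⟨m₁, m₂, m₃, m₄⟩ := hmem
  have hnd := hB.nodup h.nodup
  simp only [List.nodup_cons, List.mem_cons, List.not_mem_nil, or_false, not_or] at hnd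
  obtain ⟨z₀, hz₀, hb₀, hs₀, hB₀⟩ := h.exists_chain _ (h.tail_mem _ m₁) _ (h.tail_mem _ m₃)
  obtain ⟨z₁, hz₁, hb₁, hs₁⟩ := hR₁.exists_chain h₁ h₃
  obtain ⟨z, hzdef⟩ : ∃ z, z = z₀ + z₁ + (edgeOf d₁ + edgeOf d₃) := ⟨_, rfl⟩
  have hz : IsEdgeChain z := hzdef ▸ (hz₀.add hz₁).add
    ((isEdgeChain_edgeOf _).add (isEdgeChain_edgeOf _))
  have hzb : ∀ v, edgeBoundary z v = 0 := by
    intro v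
    have aux : ∀ a b c d : ZMod 2, a + b + (c + d) + (a + c + (b + d)) = 0 := by decide
    simp only [hzdef, edgeBoundary_add, hb₀, hb₁, edgeBoundary_edgeOf]
    exact aux _ _ _ _
  obtain ⟨l, hl₁, hl₂⟩ := exists_faceFun hz hzb
  have hnrev : ∀ e ∈ B, ∀ d : Dart, d.head ∈ R₁ → e ≠ d.rev := by
    rintro e he d hd rfl
    exact hT₁ _ hd (h.tail_mem _ he)
  have hedge : ∀ e ∈ B, ∀ d : Dart, d.head ∈ R₁ → edgeOf d e = if e = d then 1 else 0 := by
    intro e he d hd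
    rw [edgeOf_apply, if_neg (hnrev e he d hd), add_zero]
  have hzB : ∀ e ∈ B, z e = (if e = d₁ then 1 else 0) + (if e = d₃ then 1 else 0) := by
    intro e he
    have : z₁ e = 0 := by
      by_contra h'
      exact hT₁ _ (hs₁ e h').1 (h.tail_mem _ he)
    simp [hzdef, hB₀ e he, this, hedge e he _ h₁, hedge e he _ h₃]
  have hzR : ∀ e : Dart, e.1 ∈ R₂ → z e = 0 := by
    intro e he
    have a₀ : z₀ e = 0 := by
      by_contra h'
      exact hT₂ _ he (hs₀ e h').1
    have a₁ : z₁ e = 0 := by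
      by_contra h'
      exact Set.disjoint_left.1 hR (hs₁ e h').1 he
    have a₂ : ∀ d ∈ B, d.head ∈ R₁ → edgeOf d e = 0 := by
      intro d hd hd'
      refine edgeOf_eq_zero ?_ ?_
      · rintro rfl
        exact hT₂ _ he (h.tail_mem _ hd)
      · rintro rfl
        exact Set.disjoint_left.1 hR hd' he
    simp [hzdef, a₀, a₁, a₂ _ m₁ h₁, a₂ _ m₃ h₃]
  have hlR : ∀ d ∈ B, d.head ∈ R₂ → ∀ e ∈ B, e.head ∈ R₂ → l d = l e := by
    have hd : ∀ d ∈ B, d.head ∈ R₂ → l d = l d.rev := by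
      intro d hd hd'
      rw [hl₁, hl₂ d, hzB d hd, if_neg, if_neg, add_zero, add_zero]
      · rintro rfl
        exact Set.disjoint_left.1 hR h₃ hd'
      · rintro rfl
        exact Set.disjoint_left.1 hR h₁ hd'
    intro d hdB hd' e heB he'
    rw [hd d hdB hd', hd e heB he']
    exact hR₂.face_eq hl₁ hl₂ hzR hd' he'
  have hch := h.isChain hl₁
  have hBnd := h.nodup
  have hstep : ∀ (L : List Dart) (a b : Dart),
      (a :: (L ++ [b])).IsChain (fun a b => l (b.1, b.2 + 3) = l a) → (∀ e ∈ L, z e = 0) →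
      l b = l a + z b := by
    intro L
    induction L with
    | nil =>
      intro a b hc _
      rw [hl₂ b, (List.isChain_cons_cons.1 hc).1]
    | cons x L ih =>
      intro a b hc hz0
      rw [List.cons_append, List.isChain_cons_cons] at hc
      have hx : l x = l a := by rw [hl₂ x, hz0 x (by simp), add_zero, hc.1]
      rw [← hx]
      exact ih x b hc.2 fun e he => hz0 e (by simp [he])
  obtain ⟨l₀, l₁, l₂, l₃, l₄, rfl⟩ := List.sublist_four_split hB
  have c₁ := (List.isChain_split.1 hch).2
  rw [← List.cons_append, List.isChain_split] at c₁
  have c₂ := c₁.2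
  rw [← List.cons_append, List.isChain_split] at c₂
  have c₃ := c₂.2
  rw [← List.cons_append, List.isChain_split] at c₃
  have hz0 : ∀ e ∈ l₁ ++ l₂ ++ l₃, z e = 0 := by
    intro e he
    have hne : ∀ d, (d = d₁ ∨ d = d₃) → e ≠ d := by
      rintro d hd rfl
      simp only [List.nodup_append, List.nodup_cons, List.mem_append, List.mem_cons, not_or] at hBnd he
      rcases hd with rfl | rfl
      · tauto
      · rcases he with (he | he) | he
        · exact hBnd.2.1.2.2.2 _ he _ (.inr (.inr (.inl rfl))) rfl
        · exact hBnd.2.1.2.2.1.2.2.2 _ he _ (.inl rfl) rfl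
        · tauto
    rw [hzB e (by simp only [List.mem_append, List.mem_cons] at he ⊢; tauto), if_neg (hne _ (.inl rfl)),
      if_neg (hne _ (.inr rfl)), add_zero]
  have h12 := hstep _ _ _ c₁.1 fun e he => hz0 e (by simp [he])
  have h23 := hstep _ _ _ c₂.1 fun e he => hz0 e (by simp [he])
  have h34 := hstep _ _ _ c₃.1 fun e he => hz0 e (by simp [he])
  have h24 := hlR _ m₂ h₂ _ m₄ h₄
  rw [h34, h23, hzB _ m₃, hzB _ m₄, if_neg (Ne.symm hnd.1.2.1), if_pos rfl,
    if_neg (Ne.symm hnd.1.2.2), if_neg (Ne.symm hnd.2.2.1)] at h24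
  simp at h24

/-- A contour which visits a part of a connected set in a contiguous block can be extended so that
it visits the whole set in this block. -/
theorem grow {T K K₀ : Finset Vtx} {A M C : List Dart} (h : Contour (T ∪ K₀) (A ++ M ++ C))
    (hK : GConn K) (hTK : Disjoint T K) (hK₀ : K₀.Nonempty) (hK₀K : K₀ ⊆ K)
    (hA : ∀ d ∈ A, d.1 ∈ T) (hC : ∀ d ∈ C, d.1 ∈ T) (hM : ∀ d ∈ M, d.1 ∈ K₀) :
    ∃ M', Contour (T ∪ K) (A ++ M' ++ C) ∧ ∀ d ∈ M', d.1 ∈ K := by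
  have key : ∀ n, K₀.card ≤ n → n ≤ K.card → ∃ K' ⊆ K, K'.card = n ∧ K'.Nonempty ∧
      ∃ M', Contour (T ∪ K') (A ++ M' ++ C) ∧ ∀ d ∈ M', d.1 ∈ K' := by
    intro n hn
    induction n, hn using Nat.le_induction with
    | base => exact fun _ => ⟨K₀, hK₀K, rfl, hK₀, M, h, hM⟩
    | succ n hn ih =>
      intro hle
      obtain ⟨K', hK'K, hcard, ⟨w, hw⟩, M', hcon, hM'⟩ := ih (by omega)
      obtain ⟨u, hu, v, hv, hv', huv⟩ : ∃ u ∈ K', ∃ v ∈ K, v ∉ K' ∧ GridAdj u v := by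
        by_contra! hcon
        have := hK {x | x ∈ K'} ⟨w, hK'K hw, hw⟩ fun u _ hu v hv huv => by
          by_contra hv'
          exact hcon u hu v hv hv' huv
        have := Finset.card_le_card (show K ⊆ K' from this)
        omega
      obtain ⟨d, rfl, rfl⟩ := huv.exists_dart
      have hvT : d.head ∉ T := fun h' => Finset.disjoint_left.1 hTK h' hv
      have huT : d.1 ∉ T := fun h' => Finset.disjoint_left.1 hTK h' (hK'K hu)
      have hnot : d.head ∉ T ∪ K' := by simp [hvT, hv']
      have hd := hcon.mem_of_exit d (by simp [hu]) hnot
      have hd' : d ∈ M' := by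
        simp only [List.mem_append] at hd
        rcases hd with (hd | hd) | hd
        · exact absurd (hA d hd) huT
        · exact hd
        · exact absurd (hC d hd) huT
      obtain ⟨M₁, M₂, rfl⟩ := List.append_of_mem hd'
      have hstep := Contour.step (T := T ∪ K') (A := A ++ M₁) (B := M₂ ++ C) (d := d)
        (by simpa using hcon) hnot
      refine ⟨insert d.head K', Finset.insert_subset hv hK'K, by rw [Finset.card_insert_of_notMem hv', hcard],
        ⟨_, Finset.mem_insert_self _ _⟩,
        M₁ ++ (d.head, d.2 + 3) :: (d.head, d.2) :: (d.head, d.2 + 1) :: M₂, ?_, ?_⟩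
      · rw [Finset.union_insert]
        simpa using hstep
      · intro e he
        simp only [List.mem_append, List.mem_cons, Finset.mem_insert] at he hM' ⊢
        rcases he with he | rfl | rfl | rfl | he
        · exact .inr (hM' e (.inl he))
        · exact .inl rfl
        · exact .inl rfl
        · exact .inl rfl
        · exact .inr (hM' e (.inr (.inr he)))
  obtain ⟨K', hK', hcard, -, M', h1, h2⟩ := key K.card (Finset.card_le_card hK₀K) le_rfl
  obtain rfl := Finset.eq_of_subset_of_card_le hK' hcard.ge
  exact ⟨M', h1, h2⟩

/-- Every nonempty connected finite set has a contour. -/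
theorem exists_of_gconn {T : Finset Vtx} (hT : GConn T) (hne : T.Nonempty) : ∃ B, Contour T B := by
  obtain ⟨v, hv⟩ := hne
  obtain ⟨M, hM, -⟩ := grow (T := ∅) (K := T) (K₀ := {v}) (A := []) (C := [])
    (M := [(v, 0), (v, 1), (v, 2), (v, 3)]) (by simpa using Contour.single v) hT (by simp) (by simp)
    (by simpa using hv) (by simp) (by simp) (by simp)
  exact ⟨M, by simpa using hM⟩

/-- A connected set next to a contour can be absorbed, replacing one dart by a block of darts. -/
theorem absorb {T K : Finset Vtx} {A C : List Dart} {f : Dart} (h : Contour T (A ++ f :: C))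
    (hf : f.head ∈ K) (hK : GConn K) (hTK : Disjoint T K) :
    ∃ M, Contour (T ∪ K) (A ++ M ++ C) ∧ (∀ d ∈ M, d.1 ∈ K) ∧
      ∀ d : Dart, d.1 ∈ K → d.head ∉ T ∪ K → d ∈ M := by
  have hA : ∀ d ∈ A, d.1 ∈ T := fun d hd => h.tail_mem d (by simp [hd])
  have hC : ∀ d ∈ C, d.1 ∈ T := fun d hd => h.tail_mem d (by simp [hd])
  have hstep := h.step fun h' => Finset.disjoint_left.1 hTK h' hf
  obtain ⟨M, h1, h2⟩ := grow (T := T) (K := K) (K₀ := {f.head}) (A := A) (C := C)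
    (M := [(f.head, f.2 + 3), (f.head, f.2), (f.head, f.2 + 1)])
    (by rw [Finset.union_singleton]; simpa using hstep) hK hTK (by simp) (by simpa using hf) hA hC
    (by simp)
  refine ⟨M, h1, h2, fun d hd hd' => ?_⟩
  have := h1.mem_of_exit d (by simp [hd]) hd'
  simp only [List.mem_append] at this
  rcases this with (h | h) | h
  · exact absurd hd (Finset.disjoint_left.1 hTK (hA d h))
  · exact h
  · exact absurd hd (Finset.disjoint_left.1 hTK (hC d h))

end Contour

/-- The connected component of `w` in `X`. -/
def gcomp (X : Set Vtx) (w : Vtx) : Set Vtx := {v | ∃ A ⊆ X, GConn A ∧ w ∈ A ∧ v ∈ A}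

theorem gcomp_subset (X : Set Vtx) (w : Vtx) : gcomp X w ⊆ X := by
  rintro v ⟨A, hA, -, -, hv⟩
  exact hA hv

theorem mem_gcomp_self {X : Set Vtx} {w : Vtx} (h : w ∈ X) : w ∈ gcomp X w :=
  ⟨{w}, by simpa using h, gconn_singleton w, rfl, rfl⟩

theorem subset_gcomp {X A : Set Vtx} {w : Vtx} (hA : GConn A) (hAX : A ⊆ X) (hw : w ∈ A) :
    A ⊆ gcomp X w := fun _ hv => ⟨A, hAX, hA, hw, hv⟩

theorem gconn_gcomp (X : Set Vtx) (w : Vtx) : GConn (gcomp X w) := by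
  rintro P ⟨u, ⟨A, hAX, hA, hw, hu⟩, huP⟩ hP v ⟨B, hBX, hB, hw', hv⟩
  refine hA.union hB ⟨w, hw, hw'⟩ P ⟨u, .inl hu, huP⟩ (fun x hx hxP y hy hxy => ?_) v (.inr hv)
  have hsub : A ∪ B ⊆ gcomp X w :=
    union_subset (subset_gcomp hA hAX hw) (subset_gcomp hB hBX hw')
  exact hP x (hsub hx) hxP y (hsub hy) hxy

theorem mem_gcomp_of_adj {X : Set Vtx} {u v w : Vtx} (hu : u ∈ gcomp X w) (hv : v ∈ X)
    (huv : GridAdj u v) : v ∈ gcomp X w := by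
  obtain ⟨A, hAX, hA, hw, hu⟩ := hu
  refine ⟨A ∪ {v}, union_subset hAX (by simpa using hv),
    hA.union_of_adj (gconn_singleton v) hu rfl huv, .inl hw, .inr rfl⟩

theorem GConn.exists_adj {A P : Set Vtx} (hA : GConn A) {u v : Vtx} (hu : u ∈ A) (huP : u ∈ P)
    (hv : v ∈ A) (hvP : v ∉ P) : ∃ x ∈ A, x ∈ P ∧ ∃ y ∈ A, y ∉ P ∧ GridAdj x y := by
  by_contra! h
  refine hvP (hA P ⟨u, hu, huP⟩ (fun x hx hxP y hy hxy => ?_) v hv)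
  by_contra hyP
  exact h x hx hxP y hy hyP hxy

theorem GConn.exists_exit {c r s : Set Vtx} (hc : GConn c) (hr : (c ∩ r).Nonempty)
    (hs : (c ∩ s).Nonempty) (hrs : Disjoint r s) :
    ∃ (d : Dart) (P : Set Vtx), d.1 ∈ r ∧ d.head ∈ P ∧ GConn P ∧ P ⊆ c \ r ∧ (P ∩ s).Nonempty := by
  obtain ⟨v, hv, hvr⟩ := hr
  obtain ⟨w, hw, hws⟩ := hs
  have hw' : w ∈ c \ r := ⟨hw, fun h => Set.disjoint_left.1 hrs h hws⟩
  obtain ⟨x, hx, hxP, y, hy, hyP, hxy⟩ := hc.exists_adj hw (mem_gcomp_self hw') hv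
    (fun h => (gcomp_subset _ _ h).2 hvr)
  obtain ⟨d, rfl, rfl⟩ := hxy.symm.exists_dart
  refine ⟨d, gcomp (c \ r) w, ?_, hxP, gconn_gcomp _ _, gcomp_subset _ _, w, mem_gcomp_self hw', hws⟩
  by_contra hyr
  exact hyP (mem_gcomp_of_adj hxP ⟨hy, hyr⟩ hxy)

/-- There is no planar drawing of the complete graph on five vertices, with vertices represented by
disjoint connected sets. -/
theorem not_exists_five {r : Fin 5 → Finset Vtx} {c : Finset (Fin 5) → Set Vtx}
    (hr : ∀ i, GConn (r i)) (hrr : ∀ i j, i ≠ j → Disjoint (r i) (r j)) (hc : ∀ e, GConn (c e))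
    (hcc : ∀ e e', e ≠ e' → Disjoint (c e) (c e'))
    (hrc : ∀ i e, (c e ∩ r i).Nonempty ↔ i ∈ e) : False := by
  have hne : ∀ i, ∃ x, x ∈ r i := fun i => by
    obtain ⟨x, -, hx⟩ := (hrc i {i}).2 (by simp)
    exact ⟨x, hx⟩
  have hrrs : ∀ i j, i ≠ j → Disjoint (r i : Set Vtx) (r j) := fun i j h =>
    Finset.disjoint_coe.2 (hrr i j h)
  obtain ⟨B, hB⟩ := Contour.exists_of_gconn (hr 0) (hne 0)
  have hex : ∀ j : Fin 5, ∃ (d : Dart) (P : Set Vtx), j ≠ 0 → d.1 ∈ r 0 ∧ d.head ∈ P ∧ GConn P ∧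
      P ⊆ c {0, j} \ r 0 ∧ (P ∩ r j).Nonempty := by
    intro j
    by_cases hj : j = 0
    · exact ⟨((0, 0), 0), ∅, fun h => absurd hj h⟩
    · obtain ⟨d, P, h⟩ := (hc {0, j}).exists_exit ((hrc 0 {0, j}).2 (by simp))
        ((hrc j {0, j}).2 (by simp)) (hrrs 0 j (Ne.symm hj))
      exact ⟨d, P, fun _ => h⟩
  choose d P hdP using hex
  have hdB : ∀ j, j ≠ 0 → d j ∈ B := fun j hj => by
    obtain ⟨h1, h2, h3, h4, h5⟩ := hdP j hj
    exact hB.mem_of_exit _ h1 (h4 h2).2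
  have pair_ne : ∀ i j : Fin 5, i ≠ 0 → i ≠ j → ({0, i} : Finset (Fin 5)) ≠ {0, j} := by decide
  have hPP : ∀ i j, i ≠ 0 → j ≠ 0 → i ≠ j → Disjoint (P i) (P j) := by
    intro i j hi hj hij
    exact (hcc _ _ (pair_ne i j hi hij)).mono ((hdP i hi).2.2.2.1.trans sdiff_subset)
      ((hdP j hj).2.2.2.1.trans sdiff_subset)
  have hinj : ∀ i j, i ≠ 0 → j ≠ 0 → d i = d j → i = j := by
    intro i j hi hj h
    by_contra hij
    exact Set.disjoint_left.1 (hPP i j hi hj hij) (hdP i hi).2.1 (h ▸ (hdP j hj).2.1)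
  obtain ⟨D, hD⟩ : ∃ D : Finset Dart, D = ({1, 2, 3, 4} : Finset (Fin 5)).image d := ⟨_, rfl⟩
  have hDcard : D.card = 4 := by
    rw [hD, Finset.card_image_of_injOn]
    · rfl
    · intro i hi j hj h
      have h0 : ∀ i ∈ ({1, 2, 3, 4} : Finset (Fin 5)), i ≠ 0 := by decide
      exact hinj i j (h0 i hi) (h0 j hj) h
  have hDmem : ∀ x ∈ D, ∃ j, j ≠ 0 ∧ d j = x := by
    intro x hx
    have h0 : ∀ i ∈ ({1, 2, 3, 4} : Finset (Fin 5)), i ≠ 0 := by decide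
    rw [hD, Finset.mem_image] at hx
    obtain ⟨j, hj, rfl⟩ := hx
    exact ⟨j, h0 j hj, rfl⟩
  have hlen : (B.filter (· ∈ D)).length = 4 := by
    rw [← List.toFinset_card_of_nodup (hB.nodup.filter _)]
    refine Eq.trans (congrArg Finset.card ?_) hDcard
    ext x
    simp only [List.mem_toFinset, List.mem_filter, decide_eq_true_eq, and_iff_right_iff_imp]
    intro hx
    obtain ⟨j, hj, rfl⟩ := hDmem x hx
    exact hdB j hj
  have hsub : (B.filter (· ∈ D)).Sublist B := List.filter_sublist
  have hDm : ∀ x ∈ B.filter (· ∈ D), ∃ j, j ≠ 0 ∧ d j = x := by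
    intro x hx
    exact hDmem x (by simpa using (List.mem_filter.1 hx).2)
  obtain ⟨x₁, x₂, x₃, x₄, hx⟩ : ∃ x₁ x₂ x₃ x₄, B.filter (· ∈ D) = [x₁, x₂, x₃, x₄] := by
    match B.filter (· ∈ D), hlen with
    | [x₁, x₂, x₃, x₄], _ => exact ⟨_, _, _, _, rfl⟩
  rw [hx] at hsub hDm
  have hnd := hsub.nodup hB.nodup
  obtain ⟨a, ha, rfl⟩ := hDm x₁ (by simp)
  obtain ⟨b, hb, rfl⟩ := hDm x₂ (by simp)
  obtain ⟨a', ha', rfl⟩ := hDm x₃ (by simp)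
  obtain ⟨b', hb', rfl⟩ := hDm x₄ (by simp)
  have nab : a ≠ b := by rintro rfl; simp at hnd
  have naa' : a ≠ a' := by rintro rfl; simp at hnd
  have nab' : a ≠ b' := by rintro rfl; simp at hnd
  have nba' : b ≠ a' := by rintro rfl; simp at hnd
  have nbb' : b ≠ b' := by rintro rfl; simp at hnd
  have na'b' : a' ≠ b' := by rintro rfl; simp at hnd
  have hR : ∀ i j, i ≠ 0 → j ≠ 0 → i ≠ j →
      GConn (P i ∪ (r i ∪ c {i, j} ∪ r j) ∪ P j) := by
    intro i j hi hj hij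
    obtain ⟨-, -, gi, -, x, hx1, hx2⟩ := hdP i hi
    obtain ⟨-, -, gj, -, y, hy1, hy2⟩ := hdP j hj
    obtain ⟨x', hx1', hx2'⟩ := (hrc i {i, j}).2 (by simp)
    obtain ⟨y', hy1', hy2'⟩ := (hrc j {i, j}).2 (by simp)
    exact (gi.union (((hr i).union (hc _) ⟨x', hx2', hx1'⟩).union (hr j) ⟨y', .inr hy1', hy2'⟩)
      ⟨x, hx1, .inl (.inl hx2)⟩).union gj ⟨y, .inr (.inr hy2), hy1⟩
  have h0 : ∀ i j, i ≠ 0 → j ≠ 0 → ∀ v ∈ P i ∪ (r i ∪ c {i, j} ∪ r j) ∪ P j, v ∉ r 0 := by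
    rintro i j hi hj v ((hv | ((hv | hv) | hv)) | hv) hv0
    · exact ((hdP i hi).2.2.2.1 hv).2 hv0
    · exact Finset.disjoint_left.1 (hrr i 0 hi) hv hv0
    · have : ∀ i j : Fin 5, i ≠ 0 → j ≠ 0 → 0 ∉ ({i, j} : Finset (Fin 5)) := by decide
      exact this i j hi hj ((hrc 0 _).1 ⟨v, hv, hv0⟩)
    · exact Finset.disjoint_left.1 (hrr j 0 hj) hv hv0
    · exact ((hdP j hj).2.2.2.1 hv).2 hv0
  have hPr : ∀ i j, i ≠ 0 → j ≠ 0 → i ≠ j → Disjoint (P i) (r j) := by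
    intro i j hi hj hij
    refine Set.disjoint_left.2 fun v hv hv' => ?_
    have := (hrc j _).1 ⟨v, ((hdP i hi).2.2.2.1 hv).1, hv'⟩
    simp only [Finset.mem_insert, Finset.mem_singleton] at this
    exact this.elim hj hij.symm
  have hPc : ∀ i j j', i ≠ 0 → j ≠ 0 → j' ≠ 0 → Disjoint (P i) (c {j, j'}) := by
    intro i j j' hi hj hj'
    refine (hcc {0, i} {j, j'} ?_).mono_left ((hdP i hi).2.2.2.1.trans sdiff_subset)
    intro h
    have : (0 : Fin 5) ∈ ({j, j'} : Finset (Fin 5)) := by rw [← h]; simp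
    simp only [Finset.mem_insert, Finset.mem_singleton] at this
    exact this.elim hj.symm hj'.symm
  have hcr : ∀ i j k, k ≠ i → k ≠ j → Disjoint (c {i, j}) (r k) := by
    intro i j k hi hj
    refine Set.disjoint_left.2 fun v hv hv' => ?_
    have := (hrc k _).1 ⟨v, hv, hv'⟩
    simp only [Finset.mem_insert, Finset.mem_singleton] at this
    exact this.elim hi hj
  have hcc' : Disjoint (c {a, a'}) (c {b, b'}) := by
    refine hcc _ _ fun h => ?_
    have : a ∈ ({b, b'} : Finset (Fin 5)) := by rw [← h]; simp
    simp only [Finset.mem_insert, Finset.mem_singleton] at this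
    exact this.elim nab nab'
  refine hB.not_interlaced (hR a a' ha ha' naa') (hR b b' hb hb' nbb') ?_ (h0 a a' ha ha')
    (h0 b b' hb hb') hsub (.inl (.inl (hdP a ha).2.1)) (.inl (.inl (hdP b hb).2.1))
    (.inr (hdP a' ha').2.1) (.inr (hdP b' hb').2.1)
  simp only [Set.disjoint_union_left, Set.disjoint_union_right]
  refine ⟨⟨?_, ⟨?_, ?_⟩, ?_⟩, ?_⟩
  · exact ⟨⟨hPP a b ha hb nab, ⟨(hPr b a hb ha nab.symm).symm, (hPc b a a' hb ha ha').symm⟩,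
      (hPr b a' hb ha' nba').symm⟩, hPP a' b ha' hb nba'.symm⟩
  · exact ⟨⟨hPr a b ha hb nab, ⟨hrrs a b nab, hcr a a' b nab.symm nba'⟩, hrrs a' b nba'.symm⟩,
      hPr a' b ha' hb nba'.symm⟩
  · exact ⟨⟨hPc a b b' ha hb hb', ⟨(hcr b b' a nab nab').symm, hcc'⟩,
      (hcr b b' a' nba'.symm na'b').symm⟩, hPc a' b b' ha' hb hb'⟩
  · exact ⟨⟨hPr a b' ha hb' nab', ⟨hrrs a b' nab', hcr a a' b' nab'.symm na'b'.symm⟩,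
      hrrs a' b' na'b'⟩, hPr a' b' ha' hb' na'b'⟩
  · exact ⟨⟨hPP a b' ha hb' nab', ⟨(hPr b' a hb' ha nab'.symm).symm, (hPc b' a a' hb' ha ha').symm⟩,
      (hPr b' a' hb' ha' na'b'.symm).symm⟩, hPP a' b' ha' hb' na'b'⟩

/-! ### Matched words and alternations in lists -/

/-- Words of matched pairs of marks, where each matched pair may come in either order. -/
inductive MatchedWord {κ : Type*} : List (κ × Bool) → Prop
  | nil : MatchedWord []
  | node (a : κ) (o : Bool) {u v : List (κ × Bool)} (hu : MatchedWord u) (hv : MatchedWord v) :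
      MatchedWord ((a, o) :: u ++ (a, !o) :: v)

/-- Matched words in which every matched pair comes in the order prescribed by `o`; the number
is the number of outermost pairs. -/
inductive OrientedWord {κ : Type*} (o : Bool) : ℕ → List (κ × Bool) → Prop
  | nil : OrientedWord o 0 []
  | node (a : κ) {s t : ℕ} {u v : List (κ × Bool)} (hu : OrientedWord o s u)
      (hv : OrientedWord o t v) :
      OrientedWord o (t + 1) ((a, o) :: u ++ (a, !o) :: v)

section Words

variable {κ : Type*}

theorem MatchedWord.insert {w : List (κ × Bool)} (hw : MatchedWord w) (c : κ) (o : Bool) :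
    ∀ A C, w = A ++ C → MatchedWord (A ++ (c, o) :: (c, !o) :: C) := by
  induction hw with
  | nil =>
    intro A C h
    obtain ⟨rfl, rfl⟩ := List.append_eq_nil_iff.1 h.symm
    exact .node c o .nil .nil
  | @node a o' u v hu hv ihu ihv =>
    rintro (_ | ⟨x, A⟩) C h
    · rw [List.nil_append] at h
      subst h
      exact .node c o .nil (.node a o' hu hv)
    · rw [List.cons_append, List.cons_append, List.cons.injEq] at h
      obtain ⟨rfl, h⟩ := h
      rcases List.append_eq_append_iff.1 h with ⟨D, rfl, hD⟩ | ⟨D, rfl, hD⟩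
      · rcases D with _ | ⟨y, D⟩
        · simp only [List.nil_append] at hD
          subst hD
          simpa using MatchedWord.node a o' (ihu u [] (by simp)) hv
        · rw [List.cons_append, List.cons.injEq] at hD
          obtain ⟨rfl, rfl⟩ := hD
          simpa using MatchedWord.node a o' hu (ihv D C rfl)
      · subst hD
        simpa using MatchedWord.node a o' (ihu A D rfl) hv

theorem OrientedWord.append {o : Bool} {s t : ℕ} {u v : List (κ × Bool)}
    (hu : OrientedWord o s u) (hv : OrientedWord o t v) :
    ∃ n, OrientedWord o n (u ++ v) := by
  induction hu with
  | nil => exact ⟨t, hv⟩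
  | node a h₁ h₂ _ ih =>
    obtain ⟨n, hn⟩ := ih
    exact ⟨n + 1, by simpa using OrientedWord.node a h₁ hn⟩

theorem MatchedWord.split {w : List (κ × Bool)} (hw : MatchedWord w) :
    ∃ w' : Bool → List (κ × Bool), (∀ o, (w' o).Sublist w ∧ ∃ n, OrientedWord o n (w' o)) ∧
      w.length = (w' true).length + (w' false).length := by
  induction hw with
  | nil => exact ⟨fun _ => [], fun o => ⟨.refl _, 0, .nil⟩, rfl⟩
  | @node a o u v _ _ ihu ihv =>
    obtain ⟨u', hu', hul⟩ := ihu
    obtain ⟨v', hv', hvl⟩ := ihv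
    refine ⟨fun p => if p = o then (a, o) :: u' p ++ (a, !o) :: v' p else u' p ++ v' p,
      fun p => ?_, ?_⟩
    · obtain ⟨hu₁, m, hu₂⟩ := hu' p
      obtain ⟨hv₁, n, hv₂⟩ := hv' p
      by_cases hp : p = o
      · subst hp
        simp only [if_true]
        exact ⟨(hu₁.cons_cons _).append (hv₁.cons_cons _), _, .node a hu₂ hv₂⟩
      · simp only [hp, if_false]
        exact ⟨(hu₁.cons _).append (hv₁.cons _), hu₂.append hv₂⟩
    · cases o <;> simp [hul, hvl] <;> omega

end Words

section Changes

variable {L : Type*} [DecidableEq L]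

/-- The number of places where consecutive entries of a list differ. -/
def changes : List L → ℕ
  | [] => 0
  | [_] => 0
  | a :: b :: l => (if a = b then 0 else 1) + changes (b :: l)

@[simp] theorem changes_nil : changes ([] : List L) = 0 := rfl

@[simp] theorem changes_singleton (a : L) : changes [a] = 0 := rfl

theorem changes_cons_cons (a b : L) (l : List L) :
    changes (a :: b :: l) = (if a = b then 0 else 1) + changes (b :: l) := rfl

theorem changes_le_cons (a : L) (l : List L) : changes l ≤ changes (a :: l) := by
  cases l with
  | nil => simp
  | cons b l => rw [changes_cons_cons]; omega

theorem changes_cons_le (a : L) (l : List L) : changes (a :: l) ≤ changes l + 1 := by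
  cases l with
  | nil => simp
  | cons b l => rw [changes_cons_cons]; split_ifs <;> omega

theorem changes_append_cons_cons (l : List L) (a b : L) (m : List L) :
    changes (l ++ a :: b :: m) =
      changes (l ++ [a]) + (if a = b then 0 else 1) + changes (b :: m) := by
  induction l with
  | nil => simp [changes_cons_cons]
  | cons x l ih =>
    cases l with
    | nil => simp [changes_cons_cons]; omega
    | cons y l =>
      simp only [List.cons_append, changes_cons_cons] at ih ⊢
      omega

theorem changes_append_cons (l : List L) (b : L) (m : List L) :
    changes l + changes (b :: m) ≤ changes (l ++ b :: m) ∧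
      changes (l ++ b :: m) ≤ changes l + 1 + changes (b :: m) := by
  rcases l.eq_nil_or_concat with rfl | ⟨l, a, rfl⟩
  · simp
  · rw [List.concat_eq_append, List.append_assoc, List.singleton_append, changes_append_cons_cons]
    split_ifs <;> omega

theorem changes_add_le (l m : List L) : changes l + changes m ≤ changes (l ++ m) := by
  cases m with
  | nil => simp
  | cons b m => exact (changes_append_cons l b m).1

theorem changes_cons_triangle (a b : L) (l : List L) :
    changes (a :: l) ≤ changes (a :: b :: l) := by
  cases l with
  | nil => simp
  | cons c l =>
    simp only [changes_cons_cons]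
    by_cases h₁ : a = b <;> by_cases h₂ : b = c <;> simp_all
    split_ifs <;> omega

theorem List.Sublist.changes_le {l l' : List L} (h : l.Sublist l') : changes l ≤ changes l' := by
  have key : changes l ≤ changes l' ∧ ∀ x, changes (x :: l) ≤ changes (x :: l') := by
    induction h with
    | slnil => simp
    | @cons l l' a h ih =>
      exact ⟨ih.1.trans (changes_le_cons a l'), fun x => (ih.2 x).trans (changes_cons_triangle x a l')⟩
    | @cons_cons l l' a h ih =>
      refine ⟨ih.2 a, fun x => ?_⟩
      simp only [changes_cons_cons]
      have := ih.2 a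
      omega
  exact key.1

/-- A list without alternating subsequence `abab` has few changes. -/
theorem changes_add_two_le (l : List L) (hl : l ≠ [])
    (h : ∀ a b, a ≠ b → ¬ [a, b, a, b].Sublist l) : changes l + 2 ≤ 2 * l.toFinset.card := by
  induction hn : l.length using Nat.strong_induction_on generalizing l with
  | _ n ih =>
  subst hn
  obtain _ | ⟨a, l⟩ := l
  · exact absurd rfl hl
  by_cases ha : a ∈ l
  · obtain ⟨m, l', rfl, ham⟩ := List.eq_append_cons_of_mem ha
    have h₂ := ih (a :: l').length (by simp) (a :: l') (by simp)
      (fun x y hxy hs => h x y hxy ((hs.trans (List.sublist_append_right m _)).cons a)) rfl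
    by_cases hm : m = []
    · subst hm
      simpa [changes_cons_cons] using h₂
    have h₁ := ih m.length (by simp) m hm
      (fun x y hxy hs => h x y hxy ((hs.trans (List.sublist_append_left m _)).cons a)) rfl
    have hdisj : Disjoint m.toFinset (a :: l').toFinset := by
      rw [Finset.disjoint_left]
      intro b hb hb'
      rw [List.mem_toFinset] at hb hb'
      have hba : a ≠ b := by
        rintro rfl
        exact ham hb
      refine h a b hba ?_
      refine List.Sublist.cons_cons a ((List.singleton_sublist.2 hb).append (List.Sublist.cons_cons a ?_))
      rcases List.mem_cons.1 hb' with hb' | hb'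
      · exact absurd hb'.symm hba
      · exact List.singleton_sublist.2 hb'
    have hcard : m.toFinset.card + (a :: l').toFinset.card ≤ (a :: (m ++ a :: l')).toFinset.card := by
      rw [← Finset.card_union_of_disjoint hdisj]
      refine Finset.card_le_card fun x hx => ?_
      simp only [Finset.mem_union, List.mem_toFinset, List.mem_cons, List.mem_append] at hx ⊢
      tauto
    have := changes_cons_le a (m ++ a :: l')
    have := (changes_append_cons m a l').2
    omega
  · have hc : (a :: l).toFinset.card = l.toFinset.card + 1 := by
      rw [List.toFinset_cons, Finset.card_insert_of_notMem (by simpa using ha)]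
    by_cases hl' : l = []
    · subst hl'
      simp
    · have := ih l.length (by simp) l hl' (fun x y hxy hs => h x y hxy (hs.cons a)) rfl
      have := changes_cons_le a l
      omega

end Changes

section Count

variable {κ L : Type*} [DecidableEq L]

/-- The first components of the marks of a given sign in a word. -/
def wordSide (w : List (κ × Bool)) (p : Bool) : List κ := (w.filter (·.2 = p)).map Prod.fst

theorem wordSide_append (u v : List (κ × Bool)) (p : Bool) :
    wordSide (u ++ v) p = wordSide u p ++ wordSide v p := by
  simp [wordSide]

theorem wordSide_cons_self (a : κ) (p : Bool) (w : List (κ × Bool)) :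
    wordSide ((a, p) :: w) p = a :: wordSide w p := by
  simp [wordSide]

theorem wordSide_cons_of_ne (a : κ) {p q : Bool} (h : p ≠ q) (w : List (κ × Bool)) :
    wordSide ((a, p) :: w) q = wordSide w q := by
  simp [wordSide, h]

theorem wordSide_nodup {w : List (κ × Bool)} (hw : w.Nodup) (p : Bool) : (wordSide w p).Nodup := by
  refine List.Nodup.map_on ?_ (hw.filter _)
  rintro ⟨a, s⟩ hx ⟨b, t⟩ hy h
  simp only [List.mem_filter, decide_eq_true_eq] at hx hy
  exact Prod.ext h (hx.2.trans hy.2.symm)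

theorem OrientedWord.eq_nil {o : Bool} {w : List (κ × Bool)} (h : OrientedWord o 0 w) : w = [] := by
  cases h
  rfl

theorem OrientedWord.exists_of_one {o : Bool} {w : List (κ × Bool)} (h : OrientedWord o 1 w) :
    ∃ b u, w = (b, o) :: u ++ [(b, !o)] := by
  generalize ht : 1 = t at h
  cases h with
  | nil => simp at ht
  | @node a s t u v hu hv =>
    obtain rfl : t = 0 := by omega
    obtain rfl := hv.eq_nil
    exact ⟨a, u, rfl⟩

theorem OrientedWord.length_wordSide {o : Bool} {t : ℕ} {w : List (κ × Bool)}
    (h : OrientedWord o t w) : w.length = 2 * (wordSide w o).length := by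
  induction h with
  | nil => rfl
  | node a _ _ ihu ihv =>
    rw [wordSide_append, wordSide_cons_self, wordSide_cons_of_ne a (by cases o <;> simp)]
    simp [ihu, ihv]
    omega

theorem OrientedWord.exists_leaves {o : Bool} {t : ℕ} {w : List (κ × Bool)}
    (h : OrientedWord o t w) (lab : Bool → κ → L) (hnd : w.Nodup)
    (hlab : ∀ a b, lab o a = lab o b → lab (!o) a = lab (!o) b → a = b) :
    ∃ l : List κ, l.Sublist (wordSide w o) ∧ l.Sublist (wordSide w !o) ∧
      (wordSide w o).length + t ≤ 2 * l.length + changes ((wordSide w o).map (lab o)) +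
        changes ((wordSide w !o).map (lab !o)) := by
  induction h with
  | nil => exact ⟨[], by simp [wordSide]⟩
  | @node a s t u v hu hv ihu ihv =>
    have ho : o ≠ !o := by cases o <;> simp
    have e₁ : wordSide ((a, o) :: u ++ (a, !o) :: v) o = a :: (wordSide u o ++ wordSide v o) := by
      rw [wordSide_append, wordSide_cons_self, wordSide_cons_of_ne a ho.symm, List.cons_append]
    have e₂ : wordSide ((a, o) :: u ++ (a, !o) :: v) (!o) =
        wordSide u (!o) ++ a :: wordSide v (!o) := by
      rw [wordSide_append, wordSide_cons_self, wordSide_cons_of_ne a ho]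
    rw [e₁, e₂]
    rw [List.cons_append, List.nodup_cons, List.nodup_append, List.nodup_cons] at hnd
    obtain ⟨lu, hu₁, hu₂, hu₃⟩ := ihu hnd.2.1
    obtain ⟨lv, hv₁, hv₂, hv₃⟩ := ihv hnd.2.2.1.2
    have c₁ := changes_add_le ((wordSide u o).map (lab o)) ((wordSide v o).map (lab o))
    have c₂ := changes_le_cons (lab o a)
      ((wordSide u o).map (lab o) ++ (wordSide v o).map (lab o))
    have c₃ := changes_le_cons (lab (!o) a) ((wordSide v !o).map (lab !o))
    have c₄ := changes_add_le ((wordSide u !o).map (lab !o))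
      (lab (!o) a :: (wordSide v !o).map (lab !o))
    by_cases hs0 : s = 0
    · subst hs0
      obtain rfl := hu.eq_nil
      refine ⟨a :: lv, hv₁.cons_cons a, hv₂.cons_cons a, ?_⟩
      simp only [wordSide, List.filter_nil, List.map_nil, List.nil_append, List.length_cons,
        List.map_cons] at hv₃ c₂ c₃ ⊢
      omega
    refine ⟨lu ++ lv, (hu₁.append hv₁).cons a, hu₂.append (hv₂.cons a), ?_⟩
    simp only [List.length_append, List.length_cons, List.map_cons, List.map_append]
    by_cases hs1 : s = 1
    · subst hs1
      obtain ⟨b, u', rfl⟩ := hu.exists_of_one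
      have hab : a ≠ b := by
        rintro rfl
        simp at hnd
      have f₁ : wordSide ((b, o) :: u' ++ [(b, !o)]) o = b :: wordSide u' o := by
        rw [wordSide_append, wordSide_cons_self, wordSide_cons_of_ne b ho.symm]
        simp [wordSide]
      have f₂ : wordSide ((b, o) :: u' ++ [(b, !o)]) (!o) = wordSide u' (!o) ++ [b] := by
        rw [wordSide_append, wordSide_cons_self, wordSide_cons_of_ne b ho]
        simp [wordSide]
      rw [f₁] at hu₃ c₁ c₂ ⊢
      rw [f₂] at hu₃ c₄ ⊢
      have g₁ := changes_cons_cons (lab o a) (lab o b)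
        ((wordSide u' o).map (lab o) ++ (wordSide v o).map (lab o))
      have g₂ := changes_append_cons_cons ((wordSide u' !o).map (lab !o)) (lab (!o) b) (lab (!o) a)
        ((wordSide v !o).map (lab !o))
      have g₃ : (if lab o a = lab o b then 0 else 1) + (if lab (!o) b = lab (!o) a then 0 else 1)
          ≥ 1 := by
        by_cases k₁ : lab o a = lab o b
        · rw [if_neg (c := lab (!o) b = _) fun k₂ => hab (hlab a b k₁ k₂.symm)]
          omega
        · rw [if_neg k₁]
          omega
      simp only [List.map_cons, List.map_append, List.cons_append, List.append_assoc,
        List.map_nil, List.length_cons, List.nil_append] at *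
      omega
    · omega

/-- The size of a balanced word with few changes of labels. -/
theorem OrientedWord.length_le {o : Bool} {t : ℕ} {w : List (κ × Bool)}
    (h : OrientedWord o t w) (lab : Bool → κ → L) (hnd : w.Nodup)
    (hlab : ∀ a b, lab o a = lab o b → lab (!o) a = lab (!o) b → a = b) (W : Finset L)
    (hW : ∀ p a, lab p a ∈ W)
    (halt : ∀ p a b, a ≠ b → ¬ [a, b, a, b].Sublist ((wordSide w p).map (lab p))) :
    (wordSide w o).length ≤ 2 + 12 * W.card := by
  have hch : ∀ p, changes ((wordSide w p).map (lab p)) ≤ 2 * W.card := by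
    intro p
    by_cases hn : (wordSide w p).map (lab p) = []
    · simp [hn]
    · have := changes_add_two_le _ hn (halt p)
      have : ((wordSide w p).map (lab p)).toFinset.card ≤ W.card := by
        refine Finset.card_le_card fun x hx => ?_
        rw [List.mem_toFinset, List.mem_map] at hx
        obtain ⟨a, -, rfl⟩ := hx
        exact hW p a
      omega
  obtain ⟨l, h₁, h₂, h₃⟩ := h.exists_leaves lab hnd hlab
  have hl : ∀ l : List κ, l.Nodup → l.length ≤ 1 + changes (l.map (lab o)) +
      changes (l.map (lab !o)) := by
    intro l
    induction l with
    | nil => simp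
    | cons a l ih =>
      intro hnd
      cases l with
      | nil => simp
      | cons b l =>
        have := ih (List.nodup_cons.1 hnd).2
        have hab : a ≠ b := by
          rintro rfl
          simp at hnd
        simp only [List.map_cons, changes_cons_cons, List.length_cons] at this ⊢
        by_cases k₁ : lab o a = lab o b
        · rw [if_neg (c := lab (!o) a = _) fun k₂ => hab (hlab a b k₁ k₂)]
          omega
        · rw [if_neg k₁]
          omega
  have h₄ := hl l (h₁.nodup (wordSide_nodup hnd o))
  have h₅ := (h₁.map (lab o)).changes_le
  have h₆ := (h₂.map (lab !o)).changes_le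
  have h₇ := hch o
  have h₈ := hch (!o)
  omega

end Count

/-- Disjoint connected sets `K c` in a connected set `F`, each joined outside of `F` to two
connected sets of the family `R` with labels `lab false c` and `lab true c`. -/
structure Routing {κ L : Type*} (F : Finset Vtx) (K : κ → Finset Vtx) (d : Bool → κ → Dart)
    (P : Bool → κ → Set Vtx) (lab : Bool → κ → L) (R : L → Set Vtx) : Prop where
  conn_F : GConn F
  conn_K : ∀ c, GConn (K c)
  K_subset : ∀ c, K c ⊆ F
  K_disjoint : ∀ c c', c ≠ c' → Disjoint (K c) (K c')
  tail_mem : ∀ p c, (d p c).1 ∈ K c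
  head_mem : ∀ p c, (d p c).head ∈ P p c
  conn_P : ∀ p c, GConn (P p c)
  P_disjoint_F : ∀ p c, ∀ v ∈ P p c, v ∉ F
  P_disjoint : ∀ p c c', c ≠ c' → Disjoint (P p c) (P p c')
  meets : ∀ p c, (P p c ∩ R (lab p c)).Nonempty
  P_disjoint_R : ∀ p c c', lab p c ≠ lab p c' → Disjoint (P p c) (R (lab p c'))
  conn_R : ∀ p c, GConn (R (lab p c))
  R_disjoint_F : ∀ p c, ∀ v ∈ R (lab p c), v ∉ F
  R_disjoint : ∀ p c c', lab p c ≠ lab p c' → Disjoint (R (lab p c)) (R (lab p c'))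
  lab_inj : ∀ c c', lab false c = lab false c' → lab true c = lab true c' → c = c'

section Marks

variable {κ : Type*} [Fintype κ]

/-- The list of all pairs `(c, p)` for which `d p c` is the given dart. -/
noncomputable def marks (d : Bool → κ → Dart) (e : Dart) : List (κ × Bool) :=
  ((Finset.univ : Finset (κ × Bool)).filter fun m => d m.2 m.1 = e).toList

theorem mem_marks {d : Bool → κ → Dart} {e : Dart} {m : κ × Bool} :
    m ∈ marks d e ↔ d m.2 m.1 = e := by
  simp [marks]

theorem mem_flatMap_marks {d : Bool → κ → Dart} {B : List Dart} {m : κ × Bool} :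
    m ∈ B.flatMap (marks d) ↔ d m.2 m.1 ∈ B := by
  simp [List.mem_flatMap, mem_marks]

theorem nodup_flatMap_marks (d : Bool → κ → Dart) {B : List Dart} (hB : B.Nodup) :
    (B.flatMap (marks d)).Nodup := by
  rw [List.nodup_flatMap]
  refine ⟨fun e _ => Finset.nodup_toList _, hB.imp fun {a b} hab m hm hm' => ?_⟩
  rw [mem_marks] at hm hm'
  exact hab (hm.symm.trans hm')

theorem sublist_of_flatMap_marks (d : Bool → κ → Dart) {B : List Dart} {l : List (κ × Bool)}
    (h : l.Sublist (B.flatMap (marks d))) (hl : l.IsChain fun m m' => d m.2 m.1 ≠ d m'.2 m'.1) :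
    (l.map fun m => d m.2 m.1).Sublist B := by
  induction B generalizing l with
  | nil =>
    rw [List.flatMap_nil, List.sublist_nil] at h
    simp [h]
  | cons e B ih =>
    rw [List.flatMap_cons, List.sublist_append_iff] at h
    obtain ⟨l₁, l₂, rfl, h₁, h₂⟩ := h
    have hm : ∀ m ∈ l₁, d m.2 m.1 = e := fun m hm => mem_marks.1 (h₁.subset hm)
    match l₁, hm with
    | [], _ => exact (ih h₂ hl).cons e
    | [m], hm =>
      rw [List.singleton_append, List.map_cons, hm m (by simp)]
      exact (ih h₂ (List.isChain_cons.1 hl).2).cons_cons e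
    | m :: m' :: l₁, hm =>
      refine absurd ?_ (List.isChain_cons_cons.1 hl).1
      rw [hm m (by simp), hm m' (by simp)]

end Marks

namespace Routing

variable {κ L : Type*} {F : Finset Vtx} {K : κ → Finset Vtx} {d : Bool → κ → Dart}
  {P : Bool → κ → Set Vtx} {lab : Bool → κ → L} {R : L → Set Vtx}

theorem head_notMem (h : Routing F K d P lab R) (p : Bool) (c : κ) : (d p c).head ∉ F :=
  h.P_disjoint_F p c _ (h.head_mem p c)

theorem mem_of_K_subset (h : Routing F K d P lab R) {T : Finset Vtx} {B : List Dart}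
    (hB : Contour T B) (hT : T ⊆ F) {c : κ} (hc : K c ⊆ T) (p : Bool) : d p c ∈ B :=
  hB.mem_of_exit _ (hc (h.tail_mem p c)) fun h' => h.head_notMem p c (hT h')

theorem flatMap_marks_block [Fintype κ] (h : Routing F K d P lab R) {M : List Dart} {c : κ}
    (hM : M.Nodup) (htail : ∀ e ∈ M, e.1 ∈ K c) (hmem : ∀ p, d p c ∈ M) :
    ∃ o, M.flatMap (marks d) = [(c, o), (c, !o)] := by
  have hperm : (M.flatMap (marks d)).Perm [(c, true), (c, false)] := by
    rw [List.perm_ext_iff_of_nodup (nodup_flatMap_marks d hM) (by simp)]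
    rintro ⟨c', p⟩
    rw [mem_flatMap_marks]
    constructor
    · intro hm
      have : c' = c := by
        by_contra hne
        exact Finset.disjoint_left.1 (h.K_disjoint c' c hne) (h.tail_mem p c') (htail _ hm)
      subst this
      cases p <;> simp
    · intro hm
      simp only [List.mem_cons, Prod.mk.injEq, List.not_mem_nil, or_false] at hm
      obtain rfl : c' = c := by tauto
      exact hmem p
  obtain ⟨a, b, hab⟩ := List.length_eq_two.1 hperm.length_eq
  rw [hab] at hperm ⊢
  have ha := hperm.subset (show a ∈ [a, b] by simp)
  have hb := hperm.subset (show b ∈ [a, b] by simp)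
  have hne : a ≠ b := by
    have := hperm.nodup_iff.2 (by simp)
    simpa using this
  simp only [List.mem_cons, List.not_mem_nil, or_false] at ha hb
  rcases ha with rfl | rfl <;> rcases hb with rfl | rfl
  · exact absurd rfl hne
  · exact ⟨true, rfl⟩
  · exact ⟨false, rfl⟩
  · exact absurd rfl hne

theorem exists_extension [Fintype κ] (h : Routing F K d P lab R) (n : ℕ) :
    ∀ (T : Finset Vtx) (B : List Dart), Contour T B → T ⊆ F → T.Nonempty →
      (∀ c, K c ⊆ T ∨ Disjoint T (K c)) → MatchedWord (B.flatMap (marks d)) →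
      F.card - T.card ≤ n →
      ∃ T' B', Contour T' B' ∧ T' ⊆ F ∧ (∀ c, K c ⊆ T') ∧ MatchedWord (B'.flatMap (marks d)) := by
  induction n with
  | zero =>
    intro T B hB hT _ _ hw hn
    have := Finset.eq_of_subset_of_card_le hT (by omega)
    exact ⟨T, B, hB, hT, fun c => this ▸ h.K_subset c, hw⟩
  | succ n ih =>
    intro T B hB hT hne hK hw hn
    by_cases hall : ∀ c, K c ⊆ T
    · exact ⟨T, B, hB, hT, hall, hw⟩
    push Not at hall
    obtain ⟨c₀, hc₀⟩ := hall
    obtain ⟨w, hw₀, hw₁⟩ := Finset.not_subset.1 hc₀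
    obtain ⟨u, hu⟩ := hne
    obtain ⟨x, hx, hxT, y, hy, hyT, hxy⟩ := h.conn_F.exists_adj (P := (T : Set Vtx)) (hT hu) hu
      (h.K_subset c₀ hw₀) hw₁
    obtain ⟨e, rfl, rfl⟩ := hxy.exists_dart
    have heB := hB.mem_of_exit e hxT hyT
    have hmarks : marks d e = [] := by
      refine List.eq_nil_iff_forall_not_mem.2 fun m hm => ?_
      rw [mem_marks] at hm
      apply h.head_notMem m.2 m.1
      rw [hm]
      exact hy
    obtain ⟨A, C, rfl⟩ := List.append_of_mem heB
    have hw' : MatchedWord (A.flatMap (marks d) ++ C.flatMap (marks d)) := by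
      simpa [hmarks] using hw
    by_cases hc : ∃ c, e.head ∈ K c
    · obtain ⟨c, hc⟩ := hc
      have hTc : Disjoint T (K c) := by
        refine (hK c).resolve_left fun hsub => hyT (hsub hc)
      obtain ⟨M, hM, hMt, hMm⟩ := hB.absorb hc (h.conn_K c) hTc
      have hsub : T ∪ K c ⊆ F := Finset.union_subset hT (h.K_subset c)
      obtain ⟨o, ho⟩ := h.flatMap_marks_block (M := M) (c := c)
        (hM.nodup.sublist ((List.sublist_append_right A M).trans (List.sublist_append_left _ C))) hMt
        fun p => hMm _ (h.tail_mem p c) fun h' => h.head_notMem p c (hsub h')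
      refine ih _ _ hM hsub ⟨u, by simp [hu]⟩ (fun c' => ?_) ?_ ?_
      · by_cases hcc : c' = c
        · subst hcc
          exact .inl Finset.subset_union_right
        · rcases hK c' with h' | h'
          · exact .inl (h'.trans Finset.subset_union_left)
          · exact .inr (Finset.disjoint_union_left.2 ⟨h', h.K_disjoint c c' (Ne.symm hcc)⟩)
      · rw [List.flatMap_append, List.flatMap_append, ho]
        simpa using hw'.insert c o _ _ rfl
      · have h1 : (insert e.head T).card ≤ (T ∪ K c).card := by
          refine Finset.card_le_card (Finset.insert_subset ?_ Finset.subset_union_left)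
          simp [hc]
        rw [Finset.card_insert_of_notMem hyT] at h1
        omega
    · push Not at hc
      have hsub : insert e.head T ⊆ F := Finset.insert_subset hy hT
      refine ih _ _ (hB.step hyT) hsub ⟨u, by simp [hu]⟩ (fun c => ?_) ?_ ?_
      · rcases hK c with h' | h'
        · exact .inl (h'.trans (Finset.subset_insert _ _))
        · exact .inr (Finset.disjoint_insert_left.2 ⟨hc c, h'⟩)
      · have hn : ∀ k, marks d (e.head, k) = [] := by
          intro k
          refine List.eq_nil_iff_forall_not_mem.2 fun m hm => ?_
          rw [mem_marks] at hm
          have := h.tail_mem m.2 m.1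
          rw [hm] at this
          exact hc _ this
        simpa [hn] using hw'
      · rw [Finset.card_insert_of_notMem hyT]
        omega

/-- The number of routes is linear in the number of labels. -/
theorem card_le [Fintype κ] [DecidableEq L] (h : Routing F K d P lab R) (W : Finset L)
    (hW : ∀ p c, lab p c ∈ W) : Fintype.card κ ≤ 4 + 24 * W.card := by
  rcases isEmpty_or_nonempty κ with hκ | ⟨⟨c₀⟩⟩
  · simp
  obtain ⟨B₀, hB₀⟩ := Contour.exists_of_gconn (h.conn_K c₀) ⟨_, h.tail_mem true c₀⟩
  obtain ⟨o, ho⟩ := h.flatMap_marks_block hB₀.nodup hB₀.tail_mem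
    (h.mem_of_K_subset hB₀ (h.K_subset c₀) subset_rfl)
  obtain ⟨T, B, hB, hT, hall, hw⟩ := h.exists_extension _ _ _ hB₀ (h.K_subset c₀)
    ⟨_, h.tail_mem true c₀⟩ (fun c => by
      by_cases hc : c = c₀
      · exact .inl (hc ▸ subset_rfl)
      · exact .inr (h.K_disjoint _ _ (Ne.symm hc)))
    (by rw [ho]; exact MatchedWord.node c₀ o .nil .nil) le_rfl
  have hnd := nodup_flatMap_marks d hB.nodup
  have hlen : 2 * Fintype.card κ ≤ (B.flatMap (marks d)).length := by
    classical
    have : (Finset.univ : Finset (κ × Bool)) ⊆ (B.flatMap (marks d)).toFinset := fun m _ =>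
      List.mem_toFinset.2 (mem_flatMap_marks.2 (h.mem_of_K_subset hB hT (hall m.1) m.2))
    have := (Finset.card_le_card this).trans (List.toFinset_card_le _)
    rw [Finset.card_univ, Fintype.card_prod, Fintype.card_bool] at this
    omega
  have halt : ∀ p a b, a ≠ b →
      ¬ [a, b, a, b].Sublist ((wordSide (B.flatMap (marks d)) p).map (lab p)) := by
    intro p a b hab hsub
    rw [wordSide, List.map_map, List.sublist_map_iff] at hsub
    obtain ⟨l, hl, hlab⟩ := hsub
    have hlp : ∀ m ∈ l, m.2 = p := fun m hm => by
      simpa using (List.mem_filter.1 (hl.subset hm)).2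
    obtain ⟨⟨c₁, p₁⟩, ⟨c₂, p₂⟩, ⟨c₃, p₃⟩, ⟨c₄, p₄⟩, rfl⟩ : ∃ m₁ m₂ m₃ m₄, l = [m₁, m₂, m₃, m₄] := by
      have := congrArg List.length hlab
      match l, this with
      | [m₁, m₂, m₃, m₄], _ => exact ⟨_, _, _, _, rfl⟩
    simp only [List.mem_cons, List.not_mem_nil, or_false, forall_eq_or_imp, forall_eq] at hlp
    obtain ⟨rfl, rfl, rfl, rfl⟩ := hlp
    simp only [List.map_cons, List.map_nil, Function.comp_apply, List.cons.injEq, and_true] at hlab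
    obtain ⟨e₁, e₂, e₃, e₄⟩ := hlab
    have hne : ∀ c c', lab p₄ c ≠ lab p₄ c' → c ≠ c' := by
      rintro c c' hc rfl
      exact hc rfl
    have l₁₂ : lab p₄ c₁ ≠ lab p₄ c₂ := by rwa [← e₁, ← e₂]
    have l₂₁ := l₁₂.symm
    have l₃₂ : lab p₄ c₃ ≠ lab p₄ c₂ := by rwa [← e₃, ← e₂]
    have l₂₃ := l₃₂.symm
    have l₃₄ : lab p₄ c₃ ≠ lab p₄ c₄ := by rwa [← e₃, ← e₄]
    have l₄₃ := l₃₄.symm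
    have l₁₄ : lab p₄ c₁ ≠ lab p₄ c₄ := by rwa [← e₁, ← e₄]
    have l₄₁ := l₁₄.symm
    have hdne : ∀ c c', lab p₄ c ≠ lab p₄ c' → d p₄ c ≠ d p₄ c' := by
      intro c c' hc hd
      refine Set.disjoint_left.1 (h.P_disjoint p₄ c c' (hne c c' hc)) (h.head_mem p₄ c) ?_
      rw [hd]
      exact h.head_mem p₄ c'
    have hs := sublist_of_flatMap_marks d (hl.trans List.filter_sublist)
      (by simp [hdne _ _ l₁₂, hdne _ _ l₂₃, hdne _ _ l₃₄])
    simp only [List.map_cons, List.map_nil] at hs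
    have hconn : ∀ c c', lab p₄ c = lab p₄ c' →
        GConn (P p₄ c ∪ R (lab p₄ c) ∪ P p₄ c') := by
      intro c c' hcc
      obtain ⟨x, hx, hx'⟩ := h.meets p₄ c
      obtain ⟨y, hy, hy'⟩ := h.meets p₄ c'
      exact ((h.conn_P p₄ c).union (h.conn_R p₄ c) ⟨x, hx, hx'⟩).union (h.conn_P p₄ c')
        ⟨y, .inr (hcc ▸ hy'), hy⟩
    have hout : ∀ c c', ∀ v ∈ P p₄ c ∪ R (lab p₄ c) ∪ P p₄ c', v ∉ T := by
      rintro c c' v ((hv | hv) | hv) hvT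
      · exact h.P_disjoint_F _ _ v hv (hT hvT)
      · exact h.R_disjoint_F _ _ v hv (hT hvT)
      · exact h.P_disjoint_F _ _ v hv (hT hvT)
    refine hB.not_interlaced (hconn c₁ c₃ (e₁.symm.trans e₃)) (hconn c₂ c₄ (e₂.symm.trans e₄)) ?_
      (hout c₁ c₃) (hout c₂ c₄) hs (.inl (.inl (h.head_mem _ _))) (.inl (.inl (h.head_mem _ _)))
      (.inr (h.head_mem _ _)) (.inr (h.head_mem _ _))
    simp only [Set.disjoint_union_left, Set.disjoint_union_right]
    have hPP := fun c c' hc => h.P_disjoint p₄ c c' (hne c c' hc)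
    have hPR := h.P_disjoint_R p₄
    exact ⟨⟨⟨⟨hPP _ _ l₁₂, (hPR _ _ l₂₁).symm⟩, hPP _ _ l₃₂⟩,
      ⟨⟨hPR _ _ l₁₂, h.R_disjoint _ _ _ l₁₂⟩, hPR _ _ l₃₂⟩⟩,
      ⟨⟨hPP _ _ l₁₄, (hPR _ _ l₄₁).symm⟩, hPP _ _ l₃₄⟩⟩
  obtain ⟨w', hw', hsum⟩ := hw.split
  have hbound : ∀ o, (w' o).length ≤ 2 * (2 + 12 * W.card) := by
    intro o
    obtain ⟨hsub, n, hn⟩ := hw' o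
    rw [hn.length_wordSide]
    have := hn.length_le lab (hnd.sublist hsub) (fun a b h₁ h₂ => by
      cases o
      · exact h.lab_inj a b h₁ h₂
      · exact h.lab_inj a b h₂ h₁) W hW (fun p a b hab hs => halt p a b hab
        (hs.trans (((hsub.filter _).map _).map _)))
    omega
  have := hbound true
  have := hbound false
  omega

end Routing

theorem gcomp_eq_of_mem {X : Set Vtx} {v w : Vtx} (h : v ∈ gcomp X w) : gcomp X v = gcomp X w := by
  have hvX := gcomp_subset X w h
  have hw : w ∈ gcomp X w := by
    obtain ⟨A, hA, -, hwA, -⟩ := h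
    exact mem_gcomp_self (hA hwA)
  exact Subset.antisymm
    (subset_gcomp ((gconn_gcomp X v).union (gconn_gcomp X w) ⟨v, mem_gcomp_self hvX, h⟩)
      (union_subset (gcomp_subset _ _) (gcomp_subset _ _)) (.inr hw) |>.trans' subset_union_left)
    (subset_gcomp (gconn_gcomp X w) (gcomp_subset X w) h)

/-- A connected set meeting `F` and two further sets outside of `F` contains a route from a
connected part of `F` to both of these sets. -/
theorem exists_route {c F : Finset Vtx} {r : Bool → Set Vtx} (hc : GConn c)
    (hcF : ∃ x ∈ c, x ∈ F) (hr : ∀ p, ∃ x ∈ c, x ∈ r p) (hrF : ∀ p, ∀ v ∈ r p, v ∉ F)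
    (hadj : ∀ x ∈ c, x ∈ F → ∀ y ∈ c, y ∉ F → GridAdj x y → ∃ p, y ∈ r p) :
    ∃ (K : Finset Vtx) (d : Bool → Dart) (P : Bool → Set Vtx), GConn K ∧ K ⊆ F ∧ K ⊆ c ∧
      ∀ p, (d p).1 ∈ K ∧ (d p).head ∈ P p ∧ GConn (P p) ∧ (∀ v ∈ P p, v ∈ c ∧ v ∉ F) ∧
        (P p ∩ r p).Nonempty := by
  by_cases hI : ∃ v ∈ c, v ∉ F ∧ ∀ p, (gcomp (↑c \ ↑F) v ∩ r p).Nonempty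
  · obtain ⟨v, hv, hvF, hp⟩ := hI
    obtain ⟨w, hw, hwF⟩ := hcF
    obtain ⟨x, hx, hxP, y, hy, hyP, hxy⟩ := hc.exists_adj (P := gcomp (↑c \ ↑F) v) hv
      (mem_gcomp_self ⟨hv, hvF⟩) hw fun h => (gcomp_subset _ _ h).2 hwF
    have hyF : y ∈ F := by
      by_contra hyF
      exact hyP (mem_gcomp_of_adj hxP ⟨hy, hyF⟩ hxy)
    obtain ⟨d, rfl, rfl⟩ := hxy.symm.exists_dart
    exact ⟨{d.1}, fun _ => d, fun _ => gcomp (↑c \ ↑F) v, by simpa using gconn_singleton d.1,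
      by simpa using hyF, by simpa using hy, fun p => ⟨by simp, hxP, gconn_gcomp _ _,
        fun v hv => gcomp_subset _ _ hv, hp p⟩⟩
  by_cases hII : ∃ v ∈ c, v ∈ F ∧ ∀ p, ∃ x ∈ gcomp (↑c ∩ ↑F) v, ∃ y ∈ c, y ∈ r p ∧ GridAdj x y
  · obtain ⟨v, hv, hvF, hp⟩ := hII
    have hd : ∀ p, ∃ d : Dart, d.1 ∈ gcomp (↑c ∩ ↑F) v ∧ d.head ∈ c ∧ d.head ∈ r p := by
      intro p
      obtain ⟨x, hx, y, hy, hyr, hxy⟩ := hp p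
      obtain ⟨d, rfl, rfl⟩ := hxy.exists_dart
      exact ⟨d, hx, hy, hyr⟩
    choose d hd₁ hd₂ hd₃ using hd
    have hfin : (gcomp (↑c ∩ ↑F) v).Finite :=
      (c.finite_toSet.subset inter_subset_left).subset (gcomp_subset _ _)
    refine ⟨hfin.toFinset, d, fun p => {(d p).head}, by simpa using gconn_gcomp _ v, ?_, ?_,
      fun p => ⟨by simpa using hd₁ p, rfl, gconn_singleton _, ?_, _, rfl, hd₃ p⟩⟩
    · intro x hx
      exact (gcomp_subset _ _ (hfin.mem_toFinset.1 hx)).2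
    · intro x hx
      exact (gcomp_subset _ _ (hfin.mem_toFinset.1 hx)).1
    · rintro x rfl
      exact ⟨hd₂ p, hrF p _ (hd₃ p)⟩
  exfalso
  obtain ⟨u, hu, hur⟩ := hr true
  obtain ⟨w, hw, hwr⟩ := hr false
  have hself : ∀ {x}, x ∈ c → x ∉ F → x ∈ gcomp (↑c \ ↑F) x := fun h h' => mem_gcomp_self ⟨h, h'⟩
  have hselfF : ∀ {x}, x ∈ c → x ∈ F → x ∈ gcomp (↑c ∩ ↑F) x := fun h h' => mem_gcomp_self ⟨h, h'⟩
  have hno : ∀ {x}, x ∈ c → x ∉ F → (gcomp (↑c \ ↑F) x ∩ r true).Nonempty →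
      (gcomp (↑c \ ↑F) x ∩ r false).Nonempty → False := by
    intro x hx hxF h₁ h₂
    refine hI ⟨x, hx, hxF, fun p => ?_⟩
    cases p
    · exact h₂
    · exact h₁
  obtain ⟨x, hx, hxP, y, hy, hyP, hxy⟩ := hc.exists_adj
    (P := {v | (v ∉ F ∧ (gcomp (↑c \ ↑F) v ∩ r true).Nonempty) ∨
      (v ∈ F ∧ ∃ x ∈ gcomp (↑c ∩ ↑F) v, ∃ y ∈ c, y ∈ r true ∧ GridAdj x y)}) hu
    (.inl ⟨hrF _ _ hur, u, hself hu (hrF _ _ hur), hur⟩) hw (by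
      rintro (⟨hwF, hne⟩ | ⟨hwF, -⟩)
      · exact hno hw hwF hne ⟨w, hself hw hwF, hwr⟩
      · exact hrF _ _ hwr hwF)
  rcases hxP with ⟨hxF, hne⟩ | ⟨hxF, x', hx', y', hy', hyr', hxy'⟩
  · by_cases hyF : y ∈ F
    · obtain ⟨p, hp⟩ := hadj y hy hyF x hx hxF hxy.symm
      cases p
      · exact hno hx hxF hne ⟨x, hself hx hxF, hp⟩
      · exact hyP (.inr ⟨hyF, y, hselfF hy hyF, x, hx, hp, hxy.symm⟩)
    · refine hyP (.inl ⟨hyF, ?_⟩)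
      rwa [gcomp_eq_of_mem (mem_gcomp_of_adj (hself hx hxF) ⟨hy, hyF⟩ hxy)]
  · by_cases hyF : y ∈ F
    · refine hyP (.inr ⟨hyF, x', ?_, y', hy', hyr', hxy'⟩)
      rwa [gcomp_eq_of_mem (mem_gcomp_of_adj (hselfF hx hxF) ⟨hy, hyF⟩ hxy)]
    · obtain ⟨p, hp⟩ := hadj x hx hxF y hy hyF hxy
      cases p
      · refine hII ⟨x, hx, hxF, fun p => ?_⟩
        cases p
        · exact ⟨x, hselfF hx hxF, y, hy, hp, hxy⟩
        · exact ⟨x', hx', y', hy', hyr', hxy'⟩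
      · exact hyP (.inl ⟨hyF, y, hself hy hyF, hp⟩)

/-- Grounded disjoint connected sets crossing exactly one member of each of two families of disjoint
connected sets: the number of different pairs is linear. -/
theorem card_pairs_le {κ σ : Type*} [Fintype κ] [DecidableEq σ] {S : σ → Finset Vtx}
    {C : κ → Finset Vtx} {F₀ : Finset Vtx} {W : Finset σ} {lab : Bool → κ → σ}
    (hF₀ : GConn F₀) (hC : ∀ k, GConn (C k)) (hS : ∀ i ∈ W, GConn (S i))
    (hFC : ∀ k, ∃ x ∈ F₀, x ∈ C k) (hFS : ∀ i ∈ W, Disjoint F₀ (S i))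
    (hCC : ∀ k k', k ≠ k' → Disjoint (C k) (C k')) (hlab : ∀ p k, lab p k ∈ W)
    (hSS : ∀ p k k', lab p k ≠ lab p k' → Disjoint (S (lab p k)) (S (lab p k')))
    (hlabne : ∀ k k', lab true k ≠ lab false k')
    (hCS : ∀ k, ∀ i ∈ W, (∃ x ∈ C k, x ∈ S i) ↔ ∃ p, i = lab p k)
    (hinj : ∀ k k', lab false k = lab false k' → lab true k = lab true k' → k = k') :
    Fintype.card κ ≤ 4 + 24 * W.card := by
  rcases isEmpty_or_nonempty κ with hκ | ⟨⟨k₀⟩⟩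
  · simp
  obtain ⟨w, hwF, -⟩ := hFC k₀
  obtain ⟨X, hX⟩ : ∃ X : Set Vtx, X = (↑F₀ ∪ ⋃ k, (C k : Set Vtx)) \ ⋃ i ∈ W, (S i : Set Vtx) :=
    ⟨_, rfl⟩
  have hXfin : X.Finite := hX ▸
    (F₀.finite_toSet.union (finite_iUnion fun k => (C k).finite_toSet)).subset sdiff_subset
  have hfin : (gcomp X w).Finite := hXfin.subset (gcomp_subset _ _)
  obtain ⟨F, hF⟩ : ∃ F : Finset Vtx, (F : Set Vtx) = gcomp X w :=
    ⟨hfin.toFinset, hfin.coe_toFinset⟩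
  have hmemF : ∀ x, x ∈ F ↔ x ∈ gcomp X w := fun x => by rw [← hF]; rfl
  have hF₀X : ↑F₀ ⊆ X := by
    intro x hx
    rw [hX]
    refine ⟨.inl hx, ?_⟩
    simp only [mem_iUnion, not_exists]
    exact fun i hi hxi => Finset.disjoint_left.1 (hFS i hi) hx hxi
  have hF₀F : ∀ x ∈ F₀, x ∈ F := fun x hx =>
    (hmemF x).2 (subset_gcomp hF₀ hF₀X hwF hx)
  have hSF : ∀ i ∈ W, ∀ v ∈ S i, v ∉ F := by
    intro i hi v hv hvF
    have := gcomp_subset _ _ ((hmemF v).1 hvF)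
    rw [hX] at this
    exact this.2 (mem_biUnion hi hv)
  have hroute : ∀ k, _ := fun k => exists_route (c := C k) (F := F) (r := fun p => S (lab p k)) (hC k)
    (by
      obtain ⟨x, hx, hx'⟩ := hFC k
      exact ⟨x, hx', hF₀F x hx⟩)
    (fun p => (hCS k _ (hlab p k)).2 ⟨p, rfl⟩)
    (fun p => hSF _ (hlab p k))
    (by
      intro x hx hxF y hy hyF hxy
      have hyS : y ∈ ⋃ i ∈ W, (S i : Set Vtx) := by
        by_contra hyS
        refine hyF ((hmemF y).2 (mem_gcomp_of_adj ((hmemF x).1 hxF) ?_ hxy))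
        rw [hX]
        exact ⟨.inr (mem_iUnion.2 ⟨k, hy⟩), hyS⟩
      simp only [mem_iUnion] at hyS
      obtain ⟨i, hi, hyi⟩ := hyS
      obtain ⟨p, rfl⟩ := (hCS k i hi).1 ⟨y, hy, hyi⟩
      exact ⟨p, hyi⟩)
  choose K d P hK hKF hKC hroute using hroute
  have hPC : ∀ p k, P k p ⊆ C k := fun p k v hv => ((hroute k p).2.2.2.1 v hv).1
  have hR : Routing F K (fun p k => d k p) (fun p k => P k p) lab (fun i => (S i : Set Vtx)) :=
    { conn_F := by rw [hF]; exact gconn_gcomp X w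
      conn_K := hK
      K_subset := hKF
      K_disjoint := fun c c' h => (hCC c c' h).mono (hKC c) (hKC c')
      tail_mem := fun p k => (hroute k p).1
      head_mem := fun p k => (hroute k p).2.1
      conn_P := fun p k => (hroute k p).2.2.1
      P_disjoint_F := fun p k v hv => ((hroute k p).2.2.2.1 v hv).2
      P_disjoint := fun p c c' h =>
        (Finset.disjoint_coe.2 (hCC c c' h)).mono (hPC p c) (hPC p c')
      meets := fun p k => (hroute k p).2.2.2.2
      P_disjoint_R := fun p c c' h => by
        refine Set.disjoint_left.2 fun v hv hv' => ?_
        obtain ⟨q, hq⟩ := (hCS c _ (hlab p c')).1 ⟨v, hPC p c hv, hv'⟩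
        cases p <;> cases q
        · exact h hq.symm
        · exact hlabne c c' hq.symm
        · exact hlabne c' c hq
        · exact h hq.symm
      conn_R := fun p k => hS _ (hlab p k)
      R_disjoint_F := fun p k => hSF _ (hlab p k)
      R_disjoint := fun p c c' h => Finset.disjoint_coe.2 (hSS p c c' h)
      lab_inj := hinj }
  exact hR.card_le W hlab

/-- Elements `u ≠ v` lying in a common member of `𝓐`. -/
def CoMember {α : Type*} (𝓐 : Finset (Finset α)) (u v : α) : Prop :=
  u ≠ v ∧ ∃ h ∈ 𝓐, u ∈ h ∧ v ∈ h

theorem CoMember.symm {α : Type*} {𝓐 : Finset (Finset α)} {u v : α} (h : CoMember 𝓐 u v) :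
    CoMember 𝓐 v u := by
  obtain ⟨hne, s, hs, hu, hv⟩ := h
  exact ⟨hne.symm, s, hs, hv, hu⟩

/-- Number of functions separating `u` and `v` from the rest of a `k`-set. -/
theorem card_isolating_functions {α : Type*} [Fintype α] [DecidableEq α] {k m : ℕ} (hk : 1 ≤ k)
    (hm : m = 4 * k) {h : Finset α} (hcard : h.card ≤ k) {u v : α} (hu : u ∈ h) (hv : v ∈ h) (huv : u ≠ v) :
    (m : ℝ) ^ Fintype.card α ≤ 2 * (m : ℝ) ^ 2 *
      ((Finset.univ : Finset (α → Fin m)).filter fun f => (f u).val = 0 ∧ (f v).val = 1 ∧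
        ∀ s ∈ h, s ≠ u → s ≠ v → 2 ≤ (f s).val).card := by
  have hmpos : (0 : ℝ) < (m : ℝ) := by exact_mod_cast (by omega : 0 < m)
  set B : α → Finset (Fin m) := fun s =>
    if s = u then Finset.univ.filter fun x => x.val = 0
    else if s = v then Finset.univ.filter fun x => x.val = 1
    else if s ∈ h then Finset.univ.filter fun x => 2 ≤ x.val
    else Finset.univ with hB
  have hset : ((Finset.univ : Finset (α → Fin m)).filter fun f => (f u).val = 0 ∧ (f v).val = 1 ∧
        ∀ s ∈ h, s ≠ u → s ≠ v → 2 ≤ (f s).val) = Fintype.piFinset B := by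
    ext f
    simp only [Finset.mem_filter, Finset.mem_univ, true_and, Fintype.mem_piFinset, hB]
    constructor
    · rintro ⟨h1, h2, h3⟩ s
      split_ifs with a b c
      · subst a; simpa using h1
      · subst b; simpa using h2
      · simpa using h3 s c a b
      · simp
    · intro H
      refine ⟨by simpa using H u, by simpa [huv.symm] using H v, fun s hs h1 h2 => ?_⟩
      simpa [h1, h2, hs] using H s
  have c0 : (Finset.univ.filter fun x : Fin m => x.val = 0).card = 1 := by
    rw [Finset.card_eq_one]
    exact ⟨⟨0, by omega⟩, by ext x; simp [Fin.ext_iff]⟩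
  have c1 : (Finset.univ.filter fun x : Fin m => x.val = 1).card = 1 := by
    rw [Finset.card_eq_one]
    exact ⟨⟨1, by omega⟩, by ext x; simp [Fin.ext_iff]⟩
  have c2 : ((Finset.univ.filter fun x : Fin m => 2 ≤ x.val).card : ℝ) ≥ m - 2 := by
    have h1 := Finset.card_filter_add_card_filter_not (s := (Finset.univ : Finset (Fin m)))
      (fun x : Fin m => 2 ≤ x.val)
    have h2 : (Finset.univ.filter fun x : Fin m => ¬ 2 ≤ x.val).card ≤ 2 := by
      calc _ ≤ ((Finset.univ.filter fun x : Fin m => x.val = 0) ∪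
            (Finset.univ.filter fun x : Fin m => x.val = 1)).card := by
            apply Finset.card_le_card
            intro x hx
            simp at hx ⊢
            omega
        _ ≤ _ := Finset.card_union_le _ _
        _ = 2 := by rw [c0, c1]
    rw [Finset.card_univ, Fintype.card_fin] at h1
    have : m ≤ (Finset.univ.filter fun x : Fin m => 2 ≤ x.val).card + 2 := by omega
    have : (m : ℝ) ≤ (Finset.univ.filter fun x : Fin m => 2 ≤ x.val).card + 2 := by
      exact_mod_cast this
    linarith
  rw [hset, Fintype.card_piFinset]
  push_cast
  have hprod : ∏ s, ((B s).card : ℝ) = (m : ℝ) ^ Fintype.card α * ∏ s, ((B s).card / m : ℝ) := by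
    rw [Finset.prod_div_distrib, Finset.prod_const, Finset.card_univ]
    field_simp
  have hoff : ∏ s, ((B s).card / m : ℝ) = ∏ s ∈ h, ((B s).card / m : ℝ) := by
    symm
    apply Finset.prod_subset (Finset.subset_univ _)
    intro s _ hs
    have h1 : s ≠ u := by rintro rfl; exact hs hu
    have h2 : s ≠ v := by rintro rfl; exact hs hv
    simp [hB, h1, h2, hs, hmpos.ne']
  have hsplit : ∏ s ∈ h, ((B s).card / m : ℝ) =
      (1 / m) * ((1 / m) * ∏ s ∈ (h.erase u).erase v, ((B s).card / m : ℝ)) := by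
    rw [← Finset.mul_prod_erase h _ hu,
      ← Finset.mul_prod_erase (h.erase u) _ (Finset.mem_erase.2 ⟨huv.symm, hv⟩)]
    simp [hB, huv.symm, c0, c1]
  have hm4 : (m : ℝ) = 4 * k := by rw [hm]; push_cast; ring
  have hk1 : (1 : ℝ) ≤ k := by exact_mod_cast hk
  have hx0 : (0 : ℝ) ≤ 1 - 2 / m := by
    rw [sub_nonneg, div_le_one hmpos]; linarith
  have hrest : (1 - 2 / m : ℝ) ^ k ≤ ∏ s ∈ (h.erase u).erase v, ((B s).card / m : ℝ) := by
    calc (1 - 2 / m : ℝ) ^ k ≤ (1 - 2 / m : ℝ) ^ ((h.erase u).erase v).card := by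
          apply pow_le_pow_of_le_one hx0
          · have : 0 ≤ 2 / (m : ℝ) := by positivity
            linarith
          · exact ((Finset.card_erase_le).trans Finset.card_erase_le).trans hcard
      _ = ∏ s ∈ (h.erase u).erase v, (1 - 2 / m : ℝ) := by rw [Finset.prod_const]
      _ ≤ _ := by
          apply Finset.prod_le_prod
          · intros; exact hx0
          · intro s hs
            simp only [Finset.mem_erase] at hs
            have : (1 - 2 / m : ℝ) = (m - 2) / m := by field_simp
            rw [this]
            apply div_le_div_of_nonneg_right _ hmpos.le
            simpa [hB, hs.1, hs.2.1, hs.2.2] using c2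
  have hbern : (1 / 2 : ℝ) ≤ (1 - 2 / m : ℝ) ^ k := by
    have := one_add_mul_le_pow (a := -(2 / (m : ℝ))) (by linarith) k
    have h2 : (k : ℝ) * (2 / m) = 1 / 2 := by rw [hm4]; field_simp; norm_num
    calc (1 / 2 : ℝ) = 1 + k * -(2 / (m : ℝ)) := by rw [mul_neg, h2]; norm_num
      _ ≤ _ := this
      _ = _ := by ring
  rw [hprod, hoff, hsplit]
  have hQ := hbern.trans hrest
  set Q := ∏ s ∈ (h.erase u).erase v, ((B s).card / m : ℝ)
  calc (m : ℝ) ^ Fintype.card α = 2 * (m : ℝ) ^ Fintype.card α * (1 / 2) := by ring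
    _ ≤ 2 * (m : ℝ) ^ Fintype.card α * Q := by gcongr
    _ = _ := by field_simp

theorem card_functions_at {α : Type*} [Fintype α] [DecidableEq α] {m : ℕ} (s : α) (x : ℕ) :
    (m : ℝ) * ((Finset.univ : Finset (α → Fin m)).filter fun f => (f s).val = x).card
      ≤ (m : ℝ) ^ Fintype.card α := by
  set B : α → Finset (Fin m) := fun t =>
    if t = s then Finset.univ.filter fun y => y.val = x else Finset.univ with hB
  have hset : ((Finset.univ : Finset (α → Fin m)).filter fun f => (f s).val = x) =
      Fintype.piFinset B := by
    ext f
    simp only [Finset.mem_filter, Finset.mem_univ, true_and, Fintype.mem_piFinset, hB]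
    constructor
    · intro h t
      split_ifs with a
      · subst a; simpa using h
      · simp
    · intro H
      simpa using H s
  have c0 : (Finset.univ.filter fun y : Fin m => y.val = x).card ≤ 1 := by
    rw [Finset.card_le_one]
    intro a ha b hb
    simp at ha hb
    exact Fin.ext (ha.trans hb.symm)
  rw [hset, Fintype.card_piFinset, ← Finset.mul_prod_erase _ _ (Finset.mem_univ s)]
  have h2 : ∏ t ∈ Finset.univ.erase s, (B t).card = m ^ (Fintype.card α - 1) := by
    rw [Finset.prod_congr rfl (g := fun _ => m)]
    · rw [Finset.prod_const, Finset.card_erase_of_mem (Finset.mem_univ _), Finset.card_univ]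
    · intro t ht
      simp [hB, Finset.ne_of_mem_erase ht]
  rw [h2]
  have h3 : (B s).card ≤ 1 := by simpa [hB] using c0
  have hpos : 0 < Fintype.card α := Fintype.card_pos_iff.2 ⟨s⟩
  have : m * ((B s).card * m ^ (Fintype.card α - 1)) ≤ m ^ Fintype.card α := by
    calc _ ≤ m * (1 * m ^ (Fintype.card α - 1)) := by gcongr
      _ = m ^ (Fintype.card α - 1 + 1) := by ring
      _ = _ := by rw [Nat.sub_add_cancel hpos]
  exact_mod_cast this

open Classical in
/-- Random sampling: a linear bound for pairs isolated in two colour classes yields a linear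
bound for all pairs with a common member. -/
theorem card_coMember_colored_le {α : Type*} [Fintype α] [DecidableEq α] {𝓐 : Finset (Finset α)}
    {col : α → Bool} {k L : ℕ} (hk : 1 ≤ k) (hcard : ∀ h ∈ 𝓐, h.card ≤ k)
    (hpair : ∀ (a b : Bool) (X Y : Finset α) (P : Finset (α × α)), (∀ x ∈ X, col x = a) →
      (∀ y ∈ Y, col y = b) → Disjoint X Y →
      (∀ p ∈ P, p.1 ∈ X ∧ p.2 ∈ Y ∧ ∃ h ∈ 𝓐, h ∩ (X ∪ Y) = {p.1, p.2}) →
      P.card ≤ L * (X.card + Y.card)) (W : Finset α) (a b : Bool) :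
    ((W ×ˢ W).filter fun p => CoMember 𝓐 p.1 p.2 ∧ col p.1 = a ∧ col p.2 = b).card
      ≤ 16 * L * k * W.card := by
  obtain ⟨m, hm⟩ : ∃ m, m = 4 * k := ⟨_, rfl⟩
  obtain ⟨N, hN⟩ : ∃ N : ℝ, N = (m : ℝ) ^ Fintype.card α := ⟨_, rfl⟩
  set T := (W ×ˢ W).filter fun p => CoMember 𝓐 p.1 p.2 ∧ col p.1 = a ∧ col p.2 = b with hT
  have hmpos : (0 : ℝ) < (m : ℝ) := by exact_mod_cast (by omega : 0 < m)
  have hNpos : 0 < N := by rw [hN]; positivity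
  let X : (α → Fin m) → Finset α := fun f => W.filter fun s => col s = a ∧ (f s).val = 0
  let Y : (α → Fin m) → Finset α := fun f => W.filter fun s => col s = b ∧ (f s).val = 1
  let P : (α → Fin m) → α × α → Prop := fun f p =>
    p.1 ∈ X f ∧ p.2 ∈ Y f ∧ ∃ h ∈ 𝓐, h ∩ (X f ∪ Y f) = {p.1, p.2}
  have h1 : ∀ f, (T.filter (P f)).card ≤ L * ((X f).card + (Y f).card) := by
    intro f
    apply hpair a b
    · intro x hx; exact (Finset.mem_filter.1 hx).2.1
    · intro x hx; exact (Finset.mem_filter.1 hx).2.1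
    · rw [Finset.disjoint_left]
      intro x hx hy
      have e1 := (Finset.mem_filter.1 hx).2.2
      have e2 := (Finset.mem_filter.1 hy).2.2
      omega
    · intro p hp
      exact (Finset.mem_filter.1 hp).2
  have h2 : ∀ p ∈ T, N ≤ 2 * (m : ℝ) ^ 2 * (Finset.univ.filter fun f => P f p).card := by
    intro p hp
    obtain ⟨hpW, ⟨hne, h, hh, hu, hv⟩, ha, hb⟩ := Finset.mem_filter.1 hp
    obtain ⟨huW, hvW⟩ := Finset.mem_product.1 hpW
    rw [hN]
    refine (card_isolating_functions hk hm (hcard h hh) hu hv hne).trans ?_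
    refine mul_le_mul_of_nonneg_left (Nat.cast_le.2 (Finset.card_le_card fun f hf => ?_))
      (by positivity)
    obtain ⟨-, f1, f2, f3⟩ := Finset.mem_filter.1 hf
    refine Finset.mem_filter.2 ⟨Finset.mem_univ _, ?_⟩
    refine ⟨Finset.mem_filter.2 ⟨huW, ha, f1⟩, Finset.mem_filter.2 ⟨hvW, hb, f2⟩, h, hh, ?_⟩
    ext s
    simp only [Finset.mem_inter, Finset.mem_union, Finset.mem_insert, Finset.mem_singleton, X, Y,
      Finset.mem_filter]
    constructor
    · rintro ⟨hs, hs'⟩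
      by_contra! hcon
      have := f3 s hs hcon.1 hcon.2
      rcases hs' with hs' | hs' <;> omega
    · rintro (rfl | rfl)
      · exact ⟨hu, Or.inl ⟨huW, ha, f1⟩⟩
      · exact ⟨hv, Or.inr ⟨hvW, hb, f2⟩⟩
  have h3 : ∑ f, ((T.filter (P f)).card : ℝ) =
      ∑ p ∈ T, ((Finset.univ.filter fun f => P f p).card : ℝ) := by
    exact_mod_cast Finset.sum_card_bipartiteAbove_eq_sum_card_bipartiteBelow
      (s := Finset.univ) (t := T) P
  have hX : (m : ℝ) * ∑ f, ((X f).card : ℝ) ≤ W.card * N := by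
    have e : ∑ f, ((X f).card : ℝ) =
        ∑ s ∈ W, ((Finset.univ.filter fun f : α → Fin m => col s = a ∧ (f s).val = 0).card : ℝ) := by
      exact_mod_cast Finset.sum_card_bipartiteAbove_eq_sum_card_bipartiteBelow
        (s := Finset.univ) (t := W) fun (f : α → Fin m) s => col s = a ∧ (f s).val = 0
    rw [e, Finset.mul_sum, ← nsmul_eq_mul]
    apply Finset.sum_le_card_nsmul
    intro s _
    rw [hN]
    refine le_trans ?_ (card_functions_at (m := m) s 0)
    gcongr
    exact fun h => h.2
  have hY : (m : ℝ) * ∑ f, ((Y f).card : ℝ) ≤ W.card * N := by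
    have e : ∑ f, ((Y f).card : ℝ) =
        ∑ s ∈ W, ((Finset.univ.filter fun f : α → Fin m => col s = b ∧ (f s).val = 1).card : ℝ) := by
      exact_mod_cast Finset.sum_card_bipartiteAbove_eq_sum_card_bipartiteBelow
        (s := Finset.univ) (t := W) fun (f : α → Fin m) s => col s = b ∧ (f s).val = 1
    rw [e, Finset.mul_sum, ← nsmul_eq_mul]
    apply Finset.sum_le_card_nsmul
    intro s _
    rw [hN]
    refine le_trans ?_ (card_functions_at (m := m) s 1)
    gcongr
    exact fun h => h.2
  have h4 : (T.card : ℝ) * N ≤ 2 * (m : ℝ) ^ 2 * ∑ f, ((T.filter (P f)).card : ℝ) := by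
    rw [h3, Finset.mul_sum, ← nsmul_eq_mul]
    exact Finset.card_nsmul_le_sum _ _ _ h2
  have h5 : ∑ f, ((T.filter (P f)).card : ℝ) ≤
      L * (∑ f, ((X f).card : ℝ) + ∑ f, ((Y f).card : ℝ)) := by
    rw [← Finset.sum_add_distrib, Finset.mul_sum]
    apply Finset.sum_le_sum
    intro f _
    exact_mod_cast h1 f
  have h6 : (T.card : ℝ) * N ≤ (16 * L * k * W.card : ℕ) * N := by
    calc (T.card : ℝ) * N ≤ _ := h4
      _ ≤ 2 * (m : ℝ) ^ 2 * (L * (∑ f, ((X f).card : ℝ) + ∑ f, ((Y f).card : ℝ))) := by gcongr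
      _ = 2 * m * L * (m * ∑ f, ((X f).card : ℝ) + m * ∑ f, ((Y f).card : ℝ)) := by ring
      _ ≤ 2 * m * L * (W.card * N + W.card * N) := by gcongr
      _ = _ := by rw [hm]; push_cast; ring
  exact_mod_cast le_of_mul_le_mul_right h6 hNpos

open Classical in
theorem card_coMember_le {α : Type*} [Fintype α] [DecidableEq α] {𝓐 : Finset (Finset α)}
    {col : α → Bool} {k L : ℕ} (hk : 1 ≤ k) (hcard : ∀ h ∈ 𝓐, h.card ≤ k)
    (hpair : ∀ (a b : Bool) (X Y : Finset α) (P : Finset (α × α)), (∀ x ∈ X, col x = a) →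
      (∀ y ∈ Y, col y = b) → Disjoint X Y →
      (∀ p ∈ P, p.1 ∈ X ∧ p.2 ∈ Y ∧ ∃ h ∈ 𝓐, h ∩ (X ∪ Y) = {p.1, p.2}) →
      P.card ≤ L * (X.card + Y.card)) (W : Finset α) :
    ((W ×ˢ W).filter fun p => CoMember 𝓐 p.1 p.2).card ≤ 64 * L * k * W.card := by
  have hsub : ((W ×ˢ W).filter fun p => CoMember 𝓐 p.1 p.2) ⊆
      (Finset.univ : Finset (Bool × Bool)).biUnion fun ab =>
        (W ×ˢ W).filter fun p => CoMember 𝓐 p.1 p.2 ∧ col p.1 = ab.1 ∧ col p.2 = ab.2 := by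
    intro p hp
    obtain ⟨h1, h2⟩ := Finset.mem_filter.1 hp
    exact Finset.mem_biUnion.2 ⟨(col p.1, col p.2), Finset.mem_univ _,
      Finset.mem_filter.2 ⟨h1, h2, rfl, rfl⟩⟩
  refine (Finset.card_le_card hsub).trans (Finset.card_biUnion_le.trans ?_)
  refine (Finset.sum_le_card_nsmul _ _ _ fun ab _ =>
    card_coMember_colored_le hk hcard hpair W ab.1 ab.2).trans (le_of_eq ?_)
  simp
  ring

/-- Any two elements of `s` are related. -/
def IsRelClique {α : Type*} (r : α → α → Prop) (s : Finset α) : Prop :=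
  ∀ u ∈ s, ∀ v ∈ s, u ≠ v → r u v

open Classical in
/-- Cliques in a degenerate graph. -/
theorem card_cliques_le {α : Type*} [DecidableEq α] {r : α → α → Prop} {D : ℕ}
    (hD : ∀ W : Finset α, ((W ×ˢ W).filter fun p => r p.1 p.2).card ≤ D * W.card) (j : ℕ)
    (W : Finset α) :
    ((W.powersetCard (j + 1)).filter fun s => IsRelClique r s).card
      ≤ W.card * D ^ j := by
  induction hn : W.card generalizing W with
  | zero =>
    rw [Finset.card_eq_zero] at hn
    subst hn
    simp
  | succ n ih =>
    have hWne : W.Nonempty := Finset.card_pos.1 (by omega)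
    obtain ⟨v, hv, hdeg⟩ : ∃ v ∈ W, (W.filter fun u => r v u).card ≤ D := by
      by_contra! hcon
      have h1 := hD W
      have h2 : ((W ×ˢ W).filter fun p => r p.1 p.2).card =
          ∑ v ∈ W, (W.filter fun u => r v u).card := by
        rw [Finset.card_filter, Finset.sum_product]
        simp only [Finset.card_filter]
      have h3 : ∑ v ∈ W, D < ∑ v ∈ W, (W.filter fun u => r v u).card :=
        Finset.sum_lt_sum_of_nonempty hWne hcon
      rw [Finset.sum_const, smul_eq_mul, mul_comm] at h3
      omega
    have hW' : (W.erase v).card = n := by rw [Finset.card_erase_of_mem hv, hn]; rfl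
    have h1 := ih (W.erase v) hW'
    set A := ((W.erase v).powersetCard (j + 1)).filter fun s => IsRelClique r s
    have hsub : ((W.powersetCard (j + 1)).filter fun s => IsRelClique r s) ⊆
        A ∪ (((W.filter fun u => r v u).powersetCard j).image (insert v)) := by
      intro s hs
      obtain ⟨hs1, hs2⟩ := Finset.mem_filter.1 hs
      obtain ⟨hsW, hsc⟩ := Finset.mem_powersetCard.1 hs1
      rw [Finset.mem_union]
      by_cases hvs : v ∈ s
      · right
        refine Finset.mem_image.2 ⟨s.erase v, Finset.mem_powersetCard.2 ⟨?_, ?_⟩,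
          Finset.insert_erase hvs⟩
        · intro u hu
          obtain ⟨h1, h2⟩ := Finset.mem_erase.1 hu
          exact Finset.mem_filter.2 ⟨hsW h2, hs2 v hvs u h2 h1.symm⟩
        · rw [Finset.card_erase_of_mem hvs, hsc]; rfl
      · left
        refine Finset.mem_filter.2 ⟨Finset.mem_powersetCard.2 ⟨?_, hsc⟩, hs2⟩
        exact Finset.subset_erase.2 ⟨hsW, hvs⟩
    calc _ ≤ _ := Finset.card_le_card hsub
      _ ≤ A.card + _ := Finset.card_union_le _ _
      _ ≤ n * D ^ j + ((W.filter fun u => r v u).powersetCard j).card :=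
          add_le_add h1 Finset.card_image_le
      _ ≤ n * D ^ j + D ^ j := by
          rw [Finset.card_powersetCard]
          gcongr
          exact (Nat.choose_le_pow _ _).trans (Nat.pow_le_pow_left hdeg j)
      _ = _ := by ring

open Classical in
/-- A set system of bounded dual complexity whose shattered sets have at most four elements of each
colour. -/
theorem card_le_of_pairs {α : Type*} [Fintype α] [DecidableEq α] {𝓐 : Finset (Finset α)}
    {col : α → Bool} {k L : ℕ} (hk : 1 ≤ k) (hL : 1 ≤ L) (hα : 1 ≤ Fintype.card α)
    (hcard : ∀ h ∈ 𝓐, h.card ≤ k)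
    (hpair : ∀ (a b : Bool) (X Y : Finset α) (P : Finset (α × α)), (∀ x ∈ X, col x = a) →
      (∀ y ∈ Y, col y = b) → Disjoint X Y →
      (∀ p ∈ P, p.1 ∈ X ∧ p.2 ∈ Y ∧ ∃ h ∈ 𝓐, h ∩ (X ∪ Y) = {p.1, p.2}) →
      P.card ≤ L * (X.card + Y.card))
    (hfive : ∀ (a : Bool) (s : Finset α), (∀ x ∈ s, col x = a) → 𝓐.Shatters s → s.card ≠ 5) :
    𝓐.card ≤ 9 * (64 * L) ^ 7 * k ^ 7 * Fintype.card α := by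
  set D := 64 * L * k with hDdef
  have hD := card_coMember_le hk hcard hpair
  have hD1 : 1 ≤ D := Nat.mul_pos (by omega) hk
  let cl : ℕ → Finset (Finset α) := fun j =>
    ((Finset.univ : Finset α).powersetCard (j + 1)).filter
      fun s => IsRelClique (CoMember 𝓐) s
  have hsub : 𝓐.shatterer ⊆ {∅} ∪ (Finset.range 8).biUnion cl := by
    intro s hs
    rw [Finset.mem_shatterer] at hs
    rw [Finset.mem_union, Finset.mem_singleton]
    rcases s.eq_empty_or_nonempty with h0 | hne
    · exact Or.inl h0
    right
    have hcol : ∀ a, (s.filter fun x => col x = a).card ≤ 4 := by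
      intro a
      by_contra! hcon
      obtain ⟨t, ht, htc⟩ := Finset.exists_subset_card_eq (n := 5) hcon
      exact hfive a t (fun x hx => (Finset.mem_filter.1 (ht hx)).2)
        (hs.mono_right (ht.trans (Finset.filter_subset _ _))) htc
    have h8 : s.card ≤ 8 := by
      have h := Finset.card_filter_add_card_filter_not (s := s) (fun x => col x = true)
      have h1 := hcol true
      have h2 := hcol false
      simp only [Bool.not_eq_true] at h
      omega
    have hpos := hne.card_pos
    refine Finset.mem_biUnion.2 ⟨s.card - 1, Finset.mem_range.2 (by omega), Finset.mem_filter.2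
      ⟨Finset.mem_powersetCard.2 ⟨Finset.subset_univ _, by omega⟩, fun u hu v hv huv => ?_⟩⟩
    obtain ⟨h, hh, hsh⟩ := hs.exists_superset
    exact ⟨huv, h, hh, hsh hu, hsh hv⟩
  calc 𝓐.card ≤ 𝓐.shatterer.card := Finset.card_le_card_shatterer 𝓐
    _ ≤ _ := Finset.card_le_card hsub
    _ ≤ 1 + ((Finset.range 8).biUnion cl).card := Finset.card_union_le _ _
    _ ≤ 1 + 8 * (Fintype.card α * D ^ 7) := by
        gcongr
        refine Finset.card_biUnion_le.trans ?_
        refine (Finset.sum_le_card_nsmul _ _ (Fintype.card α * D ^ 7) fun j hj => ?_).trans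
          (le_of_eq (by simp))
        refine (card_cliques_le hD j Finset.univ).trans ?_
        rw [Finset.card_univ]
        have := Finset.mem_range.1 hj
        gcongr
        omega
    _ ≤ 9 * (Fintype.card α * D ^ 7) := by
        have := Nat.mul_pos hα (Nat.pow_pos (n := 7) hD1)
        omega
    _ = _ := by rw [hDdef]; ring

/-- The bound for a family of hyperedges realised by connected sets of grid points. -/
theorem card_family_le {α : Type*} [Fintype α] [DecidableEq α] {𝓐 : Finset (Finset α)}
    {col : α → Bool} {k : ℕ} (hk : 1 ≤ k) (hα : 1 ≤ Fintype.card α)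
    {S : α → Finset Vtx} {C : Finset α → Finset Vtx} {F₀ : Finset Vtx}
    (hcard : ∀ h ∈ 𝓐, h.card ≤ k) (hF₀ : GConn F₀) (hC : ∀ h ∈ 𝓐, GConn (C h))
    (hS : ∀ i, GConn (S i)) (hFC : ∀ h ∈ 𝓐, ∃ x ∈ F₀, x ∈ C h) (hFS : ∀ i, Disjoint F₀ (S i))
    (hCC : ∀ h ∈ 𝓐, ∀ h' ∈ 𝓐, h ≠ h' → Disjoint (C h) (C h'))
    (hSS : ∀ i j, i ≠ j → col i = col j → Disjoint (S i) (S j))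
    (hCS : ∀ h ∈ 𝓐, ∀ i, (∃ x ∈ C h, x ∈ S i) ↔ i ∈ h) :
    𝓐.card ≤ 9 * (64 * 28) ^ 7 * k ^ 7 * Fintype.card α := by
  refine card_le_of_pairs (col := col) hk (by norm_num) hα hcard ?_ ?_
  · intro a b X Y P hX hY hXY hP
    rcases P.eq_empty_or_nonempty with rfl | hne
    · simp
    choose! H hH using fun p hp => (hP p hp).2.2
    have hinjH : ∀ p ∈ P, ∀ q ∈ P, H p = H q → p = q := by
      intro p hp q hq hpq
      have e1 := (hH p hp).2
      have e2 := (hH q hq).2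
      rw [hpq, e2] at e1
      obtain ⟨p1, p2, -⟩ := hP p hp
      obtain ⟨q1, q2, -⟩ := hP q hq
      have m1 : p.1 ∈ ({q.1, q.2} : Finset α) := e1 ▸ by simp
      have m2 : p.2 ∈ ({q.1, q.2} : Finset α) := e1 ▸ by simp
      simp only [Finset.mem_insert, Finset.mem_singleton] at m1 m2
      have n1 : p.1 ≠ q.2 := fun h => Finset.disjoint_left.1 hXY p1 (h ▸ q2)
      have n2 : p.2 ≠ q.1 := fun h => Finset.disjoint_left.1 hXY q1 (h ▸ p2)
      exact Prod.ext (m1.resolve_right n1) (m2.resolve_left n2)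
    have key := card_pairs_le (κ := {p // p ∈ P}) (S := S) (C := fun p => C (H p.1)) (F₀ := F₀)
      (W := X ∪ Y) (lab := fun t p => if t then p.1.2 else p.1.1) hF₀
      (fun p => hC _ (hH _ p.2).1) (fun i _ => hS i) (fun p => hFC _ (hH _ p.2).1)
      (fun i _ => hFS i)
      (fun p q hpq => hCC _ (hH _ p.2).1 _ (hH _ q.2).1 fun h =>
        hpq (Subtype.ext (hinjH _ p.2 _ q.2 h))) ?_ ?_ ?_ ?_ ?_
    · rw [Fintype.card_coe, Finset.card_union_of_disjoint hXY] at key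
      obtain ⟨p, hp⟩ := hne
      have := Finset.card_pos.2 ⟨_, (hP p hp).1⟩
      omega
    · rintro (_ | _) p
      · exact Finset.mem_union_left _ (hP _ p.2).1
      · exact Finset.mem_union_right _ (hP _ p.2).2.1
    · rintro (_ | _) p q hpq
      · exact hSS _ _ hpq ((hX _ (hP _ p.2).1).trans (hX _ (hP _ q.2).1).symm)
      · exact hSS _ _ hpq ((hY _ (hP _ p.2).2.1).trans (hY _ (hP _ q.2).2.1).symm)
    · intro p q h
      replace h : p.1.2 = q.1.1 := h
      exact Finset.disjoint_left.1 hXY (hP _ q.2).1 (h ▸ (hP _ p.2).2.1)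
    · intro p i hi
      rw [hCS _ (hH _ p.2).1]
      have e := (hH _ p.2).2
      have : i ∈ H p.1 ↔ i ∈ H p.1 ∩ (X ∪ Y) := by simp only [Finset.mem_inter, hi, and_true]
      rw [this, e]
      simp
    · intro p q h1 h2
      exact Subtype.ext (Prod.ext h1 h2)
  · intro a s hs hsh h5
    let e := s.equivFinOfCardEq h5
    have hch : ∀ t : Finset (Fin 5), ∃ u ∈ 𝓐, s ∩ u = (t.map e.symm.toEmbedding).map ⟨_, Subtype.val_injective⟩ := by
      intro t
      apply hsh
      intro x hx
      simp only [Finset.mem_map, Function.Embedding.coeFn_mk] at hx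
      obtain ⟨y, -, rfl⟩ := hx
      exact y.2
    choose H hH using hch
    have hmem : ∀ t i, (e.symm i : α) ∈ H t ↔ i ∈ t := by
      intro t i
      have : (e.symm i : α) ∈ H t ↔ (e.symm i : α) ∈ s ∩ H t := by simp
      rw [this, (hH t).2]
      simp
    refine not_exists_five (r := fun i => S (e.symm i)) (c := fun t => (C (H t) : Set Vtx))
      (fun i => hS _) ?_ (fun t => hC _ (hH t).1) ?_ ?_
    · intro i j hij
      refine hSS _ _ (fun h => hij (e.symm.injective (Subtype.ext h))) ?_
      rw [hs _ (e.symm i).2, hs _ (e.symm j).2]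
    · intro t t' htt
      rw [Finset.disjoint_coe]
      refine hCC _ (hH t).1 _ (hH t').1 fun h => htt ?_
      ext i
      rw [← hmem t, ← hmem t', h]
    · intro i t
      rw [← hmem t i, ← hCS _ (hH t).1]
      rfl

theorem int_step_induction {I : Set ℤ} (hI : I.OrdConnected) {P : ℤ → Prop}
    (hup : ∀ a, a ∈ I → a + 1 ∈ I → P a → P (a + 1))
    (hdown : ∀ a, a ∈ I → a + 1 ∈ I → P (a + 1) → P a) {a b : ℤ} (ha : a ∈ I) (hb : b ∈ I)
    (hPa : P a) : P b := by
  rcases le_total a b with hab | hab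
  · have : ∀ c, a ≤ c → c ≤ b → P c := by
      intro c hc
      induction c, hc using Int.leInduction with
      | base => exact fun _ => hPa
      | succ c hc ih =>
        intro hcb
        exact hup c (hI.out ha hb ⟨hc, by omega⟩) (hI.out ha hb ⟨by omega, hcb⟩) (ih (by omega))
    exact this b hab le_rfl
  · have : ∀ c, c ≤ a → b ≤ c → P c := by
      intro c hc
      induction c, hc using Int.leInductionDown with
      | base => exact fun _ => hPa
      | pred c hc ih =>
        intro hcb
        refine hdown (c - 1) (hI.out hb ha ⟨hcb, by omega⟩) (hI.out hb ha ⟨by omega, by omega⟩) ?_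
        rw [sub_add_cancel]
        exact ih (by omega)
    exact this b hab le_rfl

theorem gconn_prod {I J : Set ℤ} (hI : I.OrdConnected) (hJ : J.OrdConnected) :
    GConn (I ×ˢ J : Set Vtx) := by
  rintro P ⟨⟨a, b⟩, ⟨ha, hb⟩, hP⟩ hstep ⟨a', b'⟩ ⟨ha', hb'⟩
  simp only at ha hb ha' hb'
  have hr : ∀ x y : ℤ, GridAdj (x, y) (x + 1, y) := fun x y => ⟨0, by simp [dirVec]⟩
  have hu : ∀ x y : ℤ, GridAdj (x, y) (x, y + 1) := fun x y => ⟨1, by simp [dirVec]⟩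
  have h1 : (a', b) ∈ P := int_step_induction hI (P := fun x => ((x, b) : Vtx) ∈ P)
    (fun x hx hx' h => hstep (x, b) ⟨hx, hb⟩ h (x + 1, b) ⟨hx', hb⟩ (hr x b))
    (fun x hx hx' h => hstep (x + 1, b) ⟨hx', hb⟩ h (x, b) ⟨hx, hb⟩ (hr x b).symm) ha ha' hP
  exact int_step_induction hJ (P := fun y => ((a', y) : Vtx) ∈ P)
    (fun y hy hy' h => hstep (a', y) ⟨ha', hy⟩ h (a', y + 1) ⟨ha', hy'⟩ (hu a' y))
    (fun y hy hy' h => hstep (a', y + 1) ⟨ha', hy'⟩ h (a', y) ⟨ha', hy⟩ (hu a' y).symm) hb hb' h1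

/-- Integers whose multiple by `δ` is within `δ` of `x`. -/
def nearInts (δ x : ℝ) : Set ℤ := {a | |x - δ * a| ≤ δ}

theorem ordConnected_nearInts {δ : ℝ} (hδ : 0 < δ) (x : ℝ) : (nearInts δ x).OrdConnected := by
  refine ⟨fun a ha b hb c hc => ?_⟩
  simp only [nearInts, mem_ofPred_eq, abs_le] at *
  have h1 : (a : ℝ) ≤ c := by exact_mod_cast hc.1
  have h2 : (c : ℝ) ≤ b := by exact_mod_cast hc.2
  constructor <;> nlinarith

theorem round_mem_nearInts {δ x y : ℝ} (hδ : 0 < δ) (h : |x - y| ≤ δ / 2) :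
    round (y / δ) ∈ nearInts δ x := by
  have h1 := abs_sub_round (y / δ)
  have h2 : |y - δ * round (y / δ)| ≤ δ / 2 := by
    have : y - δ * round (y / δ) = δ * (y / δ - round (y / δ)) := by field_simp
    rw [this, abs_mul, abs_of_pos hδ]
    nlinarith
  simp only [nearInts, mem_ofPred_eq]
  calc |x - δ * round (y / δ)| ≤ |x - y| + |y - δ * round (y / δ)| := abs_sub_le _ _ _
    _ ≤ δ := by linarith

/-- Grid points close to a point of the plane, at mesh width `δ`. -/
def nearVtx (δ : ℝ) (p : ℝ × ℝ) : Set Vtx := nearInts δ p.1 ×ˢ nearInts δ p.2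

theorem gconn_nearVtx {δ : ℝ} (hδ : 0 < δ) (p : ℝ × ℝ) : GConn (nearVtx δ p) :=
  gconn_prod (ordConnected_nearInts hδ _) (ordConnected_nearInts hδ _)

theorem exists_mem_nearVtx {δ : ℝ} (hδ : 0 < δ) {p q : ℝ × ℝ} (h : dist p q ≤ δ / 2) :
    ∃ v, v ∈ nearVtx δ p ∧ v ∈ nearVtx δ q := by
  rw [Prod.dist_eq, max_le_iff, Real.dist_eq, Real.dist_eq] at h
  have h0 : ∀ x : ℝ, |x - x| ≤ δ / 2 := fun x => by simp; positivity
  exact ⟨(round (q.1 / δ), round (q.2 / δ)),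
    ⟨round_mem_nearInts hδ h.1, round_mem_nearInts hδ h.2⟩,
    ⟨round_mem_nearInts hδ (h0 _), round_mem_nearInts hδ (h0 _)⟩⟩

theorem dist_le_of_mem_nearVtx {δ : ℝ} {p q : ℝ × ℝ} {v : Vtx} (hp : v ∈ nearVtx δ p)
    (hq : v ∈ nearVtx δ q) : dist p q ≤ 2 * δ := by
  obtain ⟨h1, h2⟩ := hp
  obtain ⟨h3, h4⟩ := hq
  simp only [nearInts, mem_ofPred_eq, abs_le] at h1 h2 h3 h4
  rw [Prod.dist_eq, max_le_iff, Real.dist_eq, Real.dist_eq, abs_le, abs_le]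
  refine ⟨⟨?_, ?_⟩, ?_, ?_⟩ <;> linarith

/-- The discretisation of a plane set at mesh width `δ`. -/
def gridApprox (δ : ℝ) (K : Set (ℝ × ℝ)) : Set Vtx := ⋃ p ∈ K, nearVtx δ p

theorem mem_gridApprox {δ : ℝ} {K : Set (ℝ × ℝ)} {v : Vtx} :
    v ∈ gridApprox δ K ↔ ∃ p ∈ K, v ∈ nearVtx δ p := by simp [gridApprox]

theorem finite_gridApprox {δ : ℝ} (hδ : 0 < δ) {K : Set (ℝ × ℝ)} (hK : IsCompact K) :
    (gridApprox δ K).Finite := by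
  obtain ⟨R, hR⟩ := hK.isBounded.subset_closedBall 0
  have hbox : ∀ (x : ℝ) (a : ℤ), |x| ≤ R → a ∈ nearInts δ x →
      a ∈ Icc (-⌈(R + δ) / δ⌉) ⌈(R + δ) / δ⌉ := by
    intro x a hx ha
    simp only [nearInts, mem_ofPred_eq, abs_le] at ha hx
    have h1 : (R + δ) / δ ≤ ⌈(R + δ) / δ⌉ := Int.le_ceil _
    have h2 : (a : ℝ) ≤ (R + δ) / δ := by rw [le_div_iff₀ hδ]; nlinarith
    have h3 : -(a : ℝ) ≤ (R + δ) / δ := by rw [le_div_iff₀ hδ]; nlinarith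
    constructor
    · have : -(⌈(R + δ) / δ⌉ : ℝ) ≤ a := by linarith
      exact_mod_cast this
    · have : (a : ℝ) ≤ ⌈(R + δ) / δ⌉ := by linarith
      exact_mod_cast this
  refine ((finite_Icc (-⌈(R + δ) / δ⌉) ⌈(R + δ) / δ⌉).prod
    (finite_Icc (-⌈(R + δ) / δ⌉) ⌈(R + δ) / δ⌉)).subset ?_
  intro v hv
  obtain ⟨p, hp, h1, h2⟩ := mem_gridApprox.1 hv
  have := hR hp
  rw [mem_closedBall_zero_iff, Prod.norm_def, max_le_iff] at this
  exact ⟨hbox _ _ this.1 h1, hbox _ _ this.2 h2⟩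

theorem gconn_gridApprox {δ : ℝ} (hδ : 0 < δ) {K : Set (ℝ × ℝ)} (hK : IsPreconnected K) :
    GConn (gridApprox δ K) := by
  rintro P ⟨u, hu, huP⟩ hstep v hv
  obtain ⟨p, hp, hup⟩ := mem_gridApprox.1 hu
  obtain ⟨q, hq, hvq⟩ := mem_gridApprox.1 hv
  have hfill : ∀ p ∈ K, (∃ u ∈ nearVtx δ p, u ∈ P) → nearVtx δ p ⊆ P := by
    intro p hp hmeet
    exact fun v hv => gconn_nearVtx hδ p P hmeet (fun u hu huP v hv hadj =>
      hstep u (mem_gridApprox.2 ⟨p, hp, hu⟩) huP v (mem_gridApprox.2 ⟨p, hp, hv⟩) hadj) v hv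
  have hiff : nearVtx δ p ⊆ P ↔ nearVtx δ q ⊆ P := by
    refine hK.induction₂ (fun p q => nearVtx δ p ⊆ P ↔ nearVtx δ q ⊆ P) ?_
      (fun _ _ _ _ _ _ h h' => h.trans h') (fun _ _ _ _ h => h.symm) hp hq
    intro x hx
    filter_upwards [self_mem_nhdsWithin,
      mem_nhdsWithin_of_mem_nhds (Metric.closedBall_mem_nhds x (half_pos hδ))] with y hy hyx
    obtain ⟨w, hwy, hwx⟩ := exists_mem_nearVtx hδ (Metric.mem_closedBall.1 hyx)
    exact ⟨fun h => hfill y hy ⟨w, hwy, h hwx⟩, fun h => hfill x hx ⟨w, hwx, h hwy⟩⟩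
  exact hiff.1 (hfill p hp ⟨u, hup, huP⟩) hvq

theorem exists_mesh_disjoint {K L : Set (ℝ × ℝ)} (hK : IsCompact K) (hL : IsCompact L)
    (h : Disjoint K L) : ∃ r : ℝ, 0 < r ∧ ∀ δ < r, ∀ v ∈ gridApprox δ K, v ∉ gridApprox δ L := by
  obtain ⟨r, hr, hd⟩ := Metric.exists_pos_forall_lt_edist hK hL.isClosed h
  refine ⟨r / 2, by positivity, fun δ hδ v hv hv' => ?_⟩
  obtain ⟨p, hp, hvp⟩ := mem_gridApprox.1 hv
  obtain ⟨q, hq, hvq⟩ := mem_gridApprox.1 hv'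
  have h1 := hd p hp q hq
  rw [edist_nndist, ENNReal.coe_lt_coe, ← NNReal.coe_lt_coe, coe_nndist] at h1
  linarith [dist_le_of_mem_nearVtx hvp hvq]

/-- Finitely many compact connected plane sets have the intersection pattern of finitely many
connected finite sets of grid points. -/
theorem exists_discretization {τ : Type*} [Finite τ] {K : τ → Set (ℝ × ℝ)}
    (hK : ∀ a, IsCompact (K a)) (hK' : ∀ a, IsPreconnected (K a)) :
    ∃ G : τ → Finset Vtx, (∀ a, GConn (G a)) ∧
      ∀ a b, (∃ v ∈ G a, v ∈ G b) ↔ (K a ∩ K b).Nonempty := by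
  have hev : ∀ᶠ δ in nhdsWithin (0 : ℝ) (Ioi 0), ∀ a b, Disjoint (K a) (K b) →
      ∀ v ∈ gridApprox δ (K a), v ∉ gridApprox δ (K b) := by
    rw [Filter.eventually_all]
    intro a
    rw [Filter.eventually_all]
    intro b
    by_cases h : Disjoint (K a) (K b)
    · obtain ⟨r, hr, H⟩ := exists_mesh_disjoint (hK a) (hK b) h
      filter_upwards [mem_nhdsWithin_of_mem_nhds (Iio_mem_nhds hr)] with δ hδ _
      exact H δ hδ
    · exact Filter.Eventually.of_forall fun _ h' => absurd h' h
  obtain ⟨δ, hdis, hδ⟩ := (hev.and self_mem_nhdsWithin).exists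
  replace hδ : 0 < δ := hδ
  refine ⟨fun a => (finite_gridApprox hδ (hK a)).toFinset, fun a => ?_, fun a b => ?_⟩
  · rw [Finite.coe_toFinset]
    exact gconn_gridApprox hδ (hK' a)
  · simp only [Finite.mem_toFinset]
    constructor
    · rintro ⟨v, hva, hvb⟩
      by_contra hcon
      exact hdis a b (disjoint_iff_inter_eq_empty.2 (not_nonempty_iff_eq_empty.1 hcon)) v hva hvb
    · rintro ⟨p, hpa, hpb⟩
      obtain ⟨v, hv, -⟩ := exists_mem_nearVtx hδ (p := p) (q := p) (by simp; positivity)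
      exact ⟨v, mem_gridApprox.2 ⟨p, hpa, hv⟩, mem_gridApprox.2 ⟨p, hpb, hv⟩⟩

theorem IsCurve.isCompact {s : Set Pt} (h : IsCurve s) : IsCompact s := by
  obtain ⟨f, hf, -, rfl⟩ := h
  exact isCompact_Icc.image_of_continuousOn hf

theorem IsCurve.isPreconnected {s : Set Pt} (h : IsCurve s) : IsPreconnected s := by
  obtain ⟨f, hf, -, rfl⟩ := h
  exact isPreconnected_Icc.image f hf

/-- Finitely many points of a path-connected set lie in a compact connected subset. -/
theorem IsPathConnected.exists_compact_connected {X τ : Type*} [TopologicalSpace X] [Finite τ]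
    {U : Set X} (hU : IsPathConnected U) {p : τ → X} (hp : ∀ a, p a ∈ U) :
    ∃ K ⊆ U, IsCompact K ∧ IsPreconnected K ∧ ∀ a, p a ∈ K := by
  obtain ⟨x, hx, hjoin⟩ := hU
  choose γ hγ using fun a => hjoin (hp a)
  refine ⟨⋃ a, range (γ a), iUnion_subset fun a => range_subset_iff.2 (hγ a),
    isCompact_iUnion fun a => isCompact_range (γ a).continuous,
    isPreconnected_iUnion ⟨x, mem_iInter.2 fun a => (γ a).source_mem_range⟩
      fun a => isPreconnected_range (γ a).continuous,
    fun a => mem_iUnion.2 ⟨a, (γ a).target_mem_range⟩⟩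

theorem stmt16 :
    ∃ A : ℝ, 0 < A ∧
      ∀ (n : ℕ) (ι : Type) (S : Fin n → Set Pt) (color : Fin n → Bool) (C : ι → Set Pt),
        (∀ i, IsPolygonalCurve (S i)) →
        (∀ k, IsPolygonalCurve (C k)) →
        Function.Injective S →
        -- no two curves of the same color intersect
        (∀ i j : Fin n, i ≠ j → color i = color j → Disjoint (S i) (S j)) →
        -- every pair of curves intersects in finitely many points
        (∀ i k, (S i ∩ C k).Finite) →
        -- the curves of `C` are pairwise disjoint
        (∀ k l : ι, k ≠ l → Disjoint (C k) (C l)) →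
        -- `C` is grounded with respect to `S`
        Grounded C S →
        -- the number of distinct hyperedges of `H(S, C)` of size at most `k` is at most
        -- `A·k^7·n`
        ∀ k : ℕ, 2 ≤ k →
          ({h : Finset (Fin n) | h.Nonempty ∧ h.card ≤ k ∧
              ∃ c : ι, ∀ i : Fin n, i ∈ h ↔ (S i ∩ C c).Nonempty}.ncard : ℝ)
            ≤ A * k ^ 7 * n := by
  refine ⟨9 * (64 * 28) ^ 7, by norm_num, ?_⟩
  intro n ι S color C hS hC _ hSS _ hCC ⟨x, hx, hground⟩ k hk
  classical
  obtain ⟨𝓐, h𝓐⟩ : ∃ 𝓐 : Finset (Finset (Fin n)), ∀ h, h ∈ 𝓐 ↔ h.Nonempty ∧ h.card ≤ k ∧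
      ∃ c : ι, ∀ i : Fin n, i ∈ h ↔ (S i ∩ C c).Nonempty :=
    ⟨_, fun h => Finite.mem_toFinset (toFinite _)⟩
  have hset : {h : Finset (Fin n) | h.Nonempty ∧ h.card ≤ k ∧
      ∃ c : ι, ∀ i : Fin n, i ∈ h ↔ (S i ∩ C c).Nonempty} = (𝓐 : Set (Finset (Fin n))) := by
    ext h
    exact (h𝓐 h).symm
  rw [hset, ncard_coe_finset]
  rcases 𝓐.eq_empty_or_nonempty with rfl | ⟨h₀, hh₀⟩
  · simp
    positivity
  have hn : 1 ≤ n := by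
    obtain ⟨i, -⟩ := ((h𝓐 h₀).1 hh₀).1
    exact i.pos
  have hch : ∀ h : {h // h ∈ 𝓐}, ∃ c : ι, ∀ i : Fin n, i ∈ h.1 ↔ (S i ∩ C c).Nonempty :=
    fun h => ((h𝓐 _).1 h.2).2.2
  choose c hc using hch
  have hcinj : Function.Injective c := by
    intro h h' e
    apply Subtype.ext
    ext i
    rw [hc h, hc h', e]
  set U := connectedComponentIn (⋃ k, S k)ᶜ x with hU
  have hopen : IsOpen (⋃ k, S k)ᶜ :=
    (isCompact_iUnion fun i => (hS i).1.isCompact).isClosed.isOpen_compl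
  have hUpath : IsPathConnected U :=
    hopen.connectedComponentIn.isConnected_iff_isPathConnected.1
      (isConnected_connectedComponentIn_iff.2 hx)
  choose p hpU hpC using hground
  obtain ⟨K, hKU, hKc, hKp, hpK⟩ := hUpath.exists_compact_connected fun h => hpU (c h)
  obtain ⟨G, hG, hGG⟩ := exists_discretization
    (K := fun t : Option (Fin n ⊕ {h // h ∈ 𝓐}) => t.elim K (Sum.elim S fun h => C (c h)))
    (by rintro (_ | i | h); exacts [hKc, (hS i).1.isCompact, (hC _).1.isCompact])
    (by rintro (_ | i | h); exacts [hKp, (hS i).1.isPreconnected, (hC _).1.isPreconnected])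
  have hdisj : ∀ a b, Disjoint (G a) (G b) ↔ ¬ ∃ v ∈ G a, v ∈ G b := fun a b => by
    simp [Finset.disjoint_left]
  have hCval : ∀ h (hh : h ∈ 𝓐), (if hh : h ∈ 𝓐 then G (some (Sum.inr ⟨h, hh⟩)) else ∅) =
      G (some (Sum.inr ⟨h, hh⟩)) := fun h hh => dif_pos hh
  have key := card_family_le (𝓐 := 𝓐) (col := color) (k := k) (by omega) (by simpa using hn)
    (S := fun i => G (some (Sum.inl i)))
    (C := fun h => if hh : h ∈ 𝓐 then G (some (Sum.inr ⟨h, hh⟩)) else ∅) (F₀ := G none)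
    (fun h hh => ((h𝓐 h).1 hh).2.1) (hG _) (fun h hh => by rw [hCval h hh]; exact hG _)
    (fun i => hG _)
    (fun h hh => by
      rw [hCval h hh, hGG]
      exact ⟨_, hpK ⟨h, hh⟩, hpC _⟩)
    (fun i => by
      rw [hdisj, hGG]
      rintro ⟨y, hyK, hyS⟩
      exact connectedComponentIn_subset _ _ (hKU hyK) (mem_iUnion.2 ⟨i, hyS⟩))
    (fun h hh h' hh' hne => by
      rw [hCval h hh, hCval h' hh', hdisj, hGG, not_nonempty_iff_eq_empty,
        ← disjoint_iff_inter_eq_empty]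
      exact hCC _ _ fun e => hne (congrArg Subtype.val (hcinj e)))
    (fun i j hij hcol => by
      rw [hdisj, hGG, not_nonempty_iff_eq_empty, ← disjoint_iff_inter_eq_empty]
      exact hSS i j hij hcol)
    (fun h hh i => by
      rw [hCval h hh, hGG, hc ⟨h, hh⟩ i, inter_comm]
      rfl)
  rw [Fintype.card_fin] at key
  exact_mod_cast key
end

section
/- For every even integer n ≥ 2 there exist a family S of n line segments in the plane, consisting of n/2 pairwise disjoint horizontal segments and n/2 pairwise disjoint vertical segments such that every horizontal segment intersects every vertical segment, and a family C of exactly n²/4 pairwise disjoint curves such that each c ∈ C intersects exactly two members of S (one horizontal and one vertical) and distinct members of C intersect distinct pairs of members of S. -/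
open Set

/-- A nondegenerate segment is a polygonal curve. -/
theorem isPolygonalCurve_segment {a b : Pt} (h : a ≠ b) : IsPolygonalCurve (segment ℝ a b) := by
  refine ⟨⟨AffineMap.lineMap a b, ?_, (AffineMap.lineMap_injective ℝ h).injOn,
    segment_eq_image_lineMap ℝ a b⟩, {(a, b)}, by simp⟩
  exact AffineMap.lineMap_continuous.continuousOn

theorem mem_segment_horizontal {x₁ x₂ y : ℝ} (h : x₁ ≤ x₂) {p : Pt} :
    p ∈ segment ℝ ((x₁, y) : Pt) (x₂, y) ↔ p.2 = y ∧ x₁ ≤ p.1 ∧ p.1 ≤ x₂ := by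
  rw [← Prod.image_mk_segment_left, segment_eq_Icc h]
  constructor
  · rintro ⟨x, hx, rfl⟩
    exact ⟨rfl, hx⟩
  · rintro ⟨rfl, hx⟩
    exact ⟨p.1, hx, rfl⟩

theorem mem_segment_vertical {x y₁ y₂ : ℝ} (h : y₁ ≤ y₂) {p : Pt} :
    p ∈ segment ℝ ((x, y₁) : Pt) (x, y₂) ↔ p.1 = x ∧ y₁ ≤ p.2 ∧ p.2 ≤ y₂ := by
  rw [← Prod.image_mk_segment_right, segment_eq_Icc h]
  constructor
  · rintro ⟨y, hy, rfl⟩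
    exact ⟨rfl, hy⟩
  · rintro ⟨rfl, hy⟩
    exact ⟨p.2, hy, rfl⟩

/-- A short segment of slope `-1` that crosses the lines `X = x` and `Y = y` near, but not at,
their common point `(x, y)`. -/
def crossSegment (x y : ℝ) : Set Pt :=
  segment ℝ (x - 1 / 8, y + 1 / 4) (x + 1 / 4, y - 1 / 8)

theorem mem_crossSegment {x y : ℝ} {p : Pt} :
    p ∈ crossSegment x y ↔ p.1 + p.2 = x + y + 1 / 8 ∧ x - 1 / 8 ≤ p.1 ∧ p.1 ≤ x + 1 / 4 := by
  obtain ⟨u, v⟩ := p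
  rw [crossSegment, segment_eq_image_lineMap]
  simp only [mem_image, mem_Icc, AffineMap.lineMap_apply_module', Prod.ext_iff, Prod.fst_add,
    Prod.snd_add, Prod.smul_fst, Prod.smul_snd, Prod.fst_sub, Prod.snd_sub, smul_eq_mul]
  constructor
  · rintro ⟨t, ⟨h₀, h₁⟩, hu, hv⟩
    refine ⟨?_, ?_, ?_⟩ <;> linarith
  · rintro ⟨h, h₀, h₁⟩
    refine ⟨(u - x + 1 / 8) * (8 / 3), ⟨?_, ?_⟩, ?_, ?_⟩ <;> linarith

theorem isPolygonalCurve_crossSegment (x y : ℝ) : IsPolygonalCurve (crossSegment x y) := by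
  refine isPolygonalCurve_segment fun h => ?_
  have := congrArg Prod.fst h
  dsimp only at this
  linarith

theorem fin_eq_of_cast_lt_add_one {m : ℕ} {i j : Fin m} (h₁ : (i : ℝ) < (j : ℝ) + 1)
    (h₂ : (j : ℝ) < (i : ℝ) + 1) : i = j := by
  norm_cast at h₁ h₂
  omega

theorem stmt17 (n : ℕ) (hn : 2 ≤ n) (he : Even n) :
    ∃ (Sh Sv : Fin (n / 2) → Set Pt) (C : Fin (n / 2) → Fin (n / 2) → Set Pt),
      -- `Sh` consists of `n/2` nondegenerate horizontal segments
      (∀ i, ∃ a b : Pt, a.2 = b.2 ∧ a ≠ b ∧ Sh i = segment ℝ a b) ∧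
      -- `Sv` consists of `n/2` nondegenerate vertical segments
      (∀ j, ∃ a b : Pt, a.1 = b.1 ∧ a ≠ b ∧ Sv j = segment ℝ a b) ∧
      -- the horizontal segments are pairwise disjoint
      (∀ i i' : Fin (n / 2), i ≠ i' → Disjoint (Sh i) (Sh i')) ∧
      -- the vertical segments are pairwise disjoint
      (∀ j j' : Fin (n / 2), j ≠ j' → Disjoint (Sv j) (Sv j')) ∧
      -- every horizontal segment intersects every vertical segment
      (∀ i j, (Sh i ∩ Sv j).Nonempty) ∧
      -- `C` consists of exactly `n²/4` distinct curves
      (∀ i j, IsPolygonalCurve (C i j)) ∧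
      Function.Injective (fun p : Fin (n / 2) × Fin (n / 2) => C p.1 p.2) ∧
      -- the curves of `C` are pairwise disjoint
      (∀ i j i' j', (i, j) ≠ (i', j') → Disjoint (C i j) (C i' j')) ∧
      -- every pair of curves intersects in finitely many points
      (∀ i j i', (C i j ∩ Sh i').Finite) ∧
      (∀ i j j', (C i j ∩ Sv j').Finite) ∧
      -- `C i j` intersects exactly two members of `S`: the horizontal segment `Sh i`
      -- and the vertical segment `Sv j` (so distinct members of `C` intersect distinct
      -- pairs of members of `S`)
      (∀ i j i', (C i j ∩ Sh i').Nonempty ↔ i' = i) ∧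
      (∀ i j j', (C i j ∩ Sv j').Nonempty ↔ j' = j) := by
  generalize n / 2 = m
  have hm (i : Fin m) : (0 : ℝ) ≤ (i : ℝ) ∧ (i : ℝ) + 1 ≤ m :=
    ⟨by positivity, by exact_mod_cast i.isLt⟩
  have hlt : (-1 : ℝ) < m := by linarith [(Nat.cast_nonneg m : (0 : ℝ) ≤ m)]
  have hdisj (i j i' j' : Fin m) (hne : (i, j) ≠ (i', j')) :
      Disjoint (crossSegment j i) (crossSegment j' i') := by
    rw [Set.disjoint_left]
    intro p h h'
    rw [mem_crossSegment] at h h'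
    apply hne
    congr 1 <;> apply fin_eq_of_cast_lt_add_one <;> linarith
  have hne (i j : Fin m) : (crossSegment j i).Nonempty := ⟨_, left_mem_segment ℝ _ _⟩
  refine ⟨fun i => segment ℝ (-1, (i : ℝ)) ((m : ℝ), (i : ℝ)),
    fun j => segment ℝ ((j : ℝ), -1) ((j : ℝ), (m : ℝ)), fun i j => crossSegment j i,
    fun i => ⟨(-1, (i : ℝ)), ((m : ℝ), (i : ℝ)), rfl, fun h => hlt.ne (congrArg Prod.fst h), rfl⟩,
    fun j => ⟨((j : ℝ), -1), ((j : ℝ), (m : ℝ)), rfl, fun h => hlt.ne (congrArg Prod.snd h), rfl⟩,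
    ?_, ?_, ?_,
    fun i j => isPolygonalCurve_crossSegment _ _, ?_, hdisj, ?_, ?_, ?_, ?_⟩
  · intro i i' hii
    rw [Set.disjoint_left]
    intro p h h'
    rw [mem_segment_horizontal hlt.le] at h h'
    exact hii (fin_eq_of_cast_lt_add_one (by linarith) (by linarith))
  · intro j j' hjj
    rw [Set.disjoint_left]
    intro p h h'
    rw [mem_segment_vertical hlt.le] at h h'
    exact hjj (fin_eq_of_cast_lt_add_one (by linarith) (by linarith))
  · intro i j
    refine ⟨((j : ℝ), (i : ℝ)), (mem_segment_horizontal hlt.le).2 ⟨rfl, ?_, ?_⟩,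
      (mem_segment_vertical hlt.le).2 ⟨rfl, ?_, ?_⟩⟩ <;> linarith [hm i, hm j]
  · rintro ⟨i, j⟩ ⟨i', j'⟩ h
    by_contra hij
    have hd := hdisj i j i' j' hij
    dsimp only at h
    rw [← h, disjoint_self] at hd
    exact (hne i j).ne_empty hd
  · intro i j i'
    refine (Set.finite_singleton ((j : ℝ) + i + 1 / 8 - i', (i' : ℝ))).subset ?_
    rintro p ⟨h, h'⟩
    rw [mem_crossSegment] at h
    rw [mem_segment_horizontal hlt.le] at h'
    exact Prod.ext (by dsimp only; linarith) h'.1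
  · intro i j j'
    refine (Set.finite_singleton ((j' : ℝ), (j : ℝ) + i + 1 / 8 - j')).subset ?_
    rintro p ⟨h, h'⟩
    rw [mem_crossSegment] at h
    rw [mem_segment_vertical hlt.le] at h'
    exact Prod.ext h'.1 (by dsimp only; linarith)
  · intro i j i'
    constructor
    · rintro ⟨p, h, h'⟩
      rw [mem_crossSegment] at h
      rw [mem_segment_horizontal hlt.le] at h'
      exact fin_eq_of_cast_lt_add_one (by linarith) (by linarith)
    · rintro rfl
      refine ⟨((j : ℝ) + 1 / 8, (i' : ℝ)), mem_crossSegment.2 ⟨?_, ?_, ?_⟩,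
        (mem_segment_horizontal hlt.le).2 ⟨rfl, ?_, ?_⟩⟩ <;> dsimp only <;> linarith [hm j]
  · intro i j j'
    constructor
    · rintro ⟨p, h, h'⟩
      rw [mem_crossSegment] at h
      rw [mem_segment_vertical hlt.le] at h'
      exact fin_eq_of_cast_lt_add_one (by linarith) (by linarith)
    · rintro rfl
      refine ⟨((j' : ℝ), (i : ℝ) + 1 / 8), mem_crossSegment.2 ⟨?_, ?_, ?_⟩,
        (mem_segment_vertical hlt.le).2 ⟨rfl, ?_, ?_⟩⟩ <;> dsimp only <;> linarith [hm i]
end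

section
/- Let s_1, s_2, …, s_m be a sequence whose entries come from a set of n symbols, such that s_i ≠ s_{i+1} for every 1 ≤ i ≤ m − 1, and such that there are no indices i_1 < i_2 < i_3 < i_4 with s_{i_1} = s_{i_3}, s_{i_2} = s_{i_4} and s_{i_1} ≠ s_{i_2}. Then m ≤ 2n − 1. -/
/-- In a sequence without alternation `a, b, a, b`, each pair of consecutive distinct entries
consists of a last occurrence followed by an arbitrary entry, or of an arbitrary entry followed by
a first occurrence. -/
theorem last_occurrence_or_first_occurrence {α : Type*} {k : ℕ} (s : Fin (k + 1) → α)
    (hadj : ∀ i : Fin k, s i.castSucc ≠ s i.succ)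
    (habab : ¬ ∃ i₁ i₂ i₃ i₄ : Fin (k + 1), i₁ < i₂ ∧ i₂ < i₃ ∧ i₃ < i₄ ∧
      s i₁ = s i₃ ∧ s i₂ = s i₄ ∧ s i₁ ≠ s i₂) (i : Fin k) :
    (∀ j, i.castSucc < j → s j ≠ s i.castSucc) ∨ (∀ j, j < i.succ → s j ≠ s i.succ) := by
  by_contra! h
  obtain ⟨⟨l, hil, hl⟩, j, hji, hj⟩ := h
  refine habab ⟨j, i.castSucc, i.succ, l, ?_, Fin.castSucc_lt_succ, ?_, hj, hl.symm, ?_⟩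
  · refine lt_of_le_of_ne (Fin.le_castSucc_iff.2 hji) ?_
    rintro rfl
    exact hadj i hj
  · refine lt_of_le_of_ne (Fin.castSucc_lt_iff_succ_le.1 hil) ?_
    rintro rfl
    exact hadj i hl.symm
  · rw [hj]
    exact (hadj i).symm

theorem stmt19 {α : Type*} (n m : ℕ) (A : Finset α) (hA : A.card = n)
    -- `s` is a sequence of length `m` over a set of `n` symbols
    (s : Fin m → α) (hmem : ∀ i, s i ∈ A)
    -- no two consecutive entries are equal
    (hadj : ∀ (i : ℕ) (hi : i + 1 < m), s ⟨i, Nat.lt_of_succ_lt hi⟩ ≠ s ⟨i + 1, hi⟩)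
    -- there is no subsequence of the form `a, b, a, b` with `a ≠ b`
    (habab : ¬ ∃ i₁ i₂ i₃ i₄ : Fin m, i₁ < i₂ ∧ i₂ < i₃ ∧ i₃ < i₄ ∧
      s i₁ = s i₃ ∧ s i₂ = s i₄ ∧ s i₁ ≠ s i₂) :
    m ≤ 2 * n - 1 := by
  classical
  obtain _ | k := m
  · exact Nat.zero_le _
  have hcover := last_occurrence_or_first_occurrence s
    (fun i => hadj i (Nat.succ_lt_succ i.isLt)) habab
  let L : Finset (Fin k) := {i | ∀ j, i.castSucc < j → s j ≠ s i.castSucc}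
  let F : Finset (Fin k) := {i | ∀ j, j < i.succ → s j ≠ s i.succ}
  have hL : L.card ≤ (A.erase (s (Fin.last k))).card := by
    refine Finset.card_le_card_of_injOn (fun i => s i.castSucc) ?_ ?_
    · intro i hi
      have hi' := (Finset.mem_filter.1 hi).2
      exact Finset.mem_erase.2 ⟨(hi' _ (Fin.castSucc_lt_last i)).symm, hmem _⟩
    · intro i hi j hj hij
      have hi' := (Finset.mem_filter.1 hi).2
      have hj' := (Finset.mem_filter.1 hj).2
      rcases lt_trichotomy i j with h | h | h
      · exact absurd hij.symm (hi' _ (Fin.castSucc_lt_castSucc_iff.2 h))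
      · exact h
      · exact absurd hij (hj' _ (Fin.castSucc_lt_castSucc_iff.2 h))
  have hF : F.card ≤ (A.erase (s 0)).card := by
    refine Finset.card_le_card_of_injOn (fun i => s i.succ) ?_ ?_
    · intro i hi
      have hi' := (Finset.mem_filter.1 hi).2
      exact Finset.mem_erase.2 ⟨(hi' _ (Fin.succ_pos i)).symm, hmem _⟩
    · intro i hi j hj hij
      have hi' := (Finset.mem_filter.1 hi).2
      have hj' := (Finset.mem_filter.1 hj).2
      rcases lt_trichotomy i j with h | h | h
      · exact absurd hij (hj' _ (Fin.succ_lt_succ_iff.2 h))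
      · exact h
      · exact absurd hij.symm (hi' _ (Fin.succ_lt_succ_iff.2 h))
  have hunion : L ∪ F = Finset.univ := by
    ext i
    simpa [L, F] using hcover i
  have hk : k ≤ L.card + F.card := by
    simpa [hunion] using Finset.card_union_le L F
  rw [Finset.card_erase_of_mem (hmem _), hA] at hL hF
  have hpos : 0 < n := hA ▸ Finset.card_pos.2 ⟨_, hmem 0⟩
  omega
end
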